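/- For every integer n ≥ 1, the sum over all fully commutative involutions w of the Coxeter group of type D_{n+1} of q^{maj(w)} equals P_n(q) + (q^{2n+1} − q^n)·[n−1 choose ⌊(n−1)/2⌋]_q + [n+1 choose ⌊(n+1)/2⌋]_q, as elements of ℚ[q], where for n even P_n(q) := Σ_{h=1}^{n−1} q^h Σ_{i=0}^{h−1} [h−1 choose i]_q + (1/2)q^n(1+q) Σ_{i=0}^{n−1} [n−1 choose i]_q, and for n odd P_n(q) := Σ_{h=1}^{n−1} q^h Σ_{i=0}^{h−1} [h−1 choose i]_q + (1/2)q^n(1+q) Σ_{i=0}^{n−1} [n−1 choose i]_q + Σ_{h=1}^{(n−1)/2} q^{n−h} [n−h−1 choose (n−1)/2]_q + (1/2)q^n(1+q) [n−1 choose (n−1)/2]_q. -/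

import Mathlib

open CoxeterSystem

/-- A single commutation move: transposition of two adjacent letters `a`, `b`
with `M a b = 2`. -/
def CommMove {B : Type*} (M : CoxeterMatrix B) (w w' : List B) : Prop :=
  ∃ (u v : List B) (a b : B), M a b = 2 ∧ w = u ++ a :: b :: v ∧ w' = u ++ b :: a :: v

/-- Commutation equivalence of words: two words are commutation-equivalent if one can be
obtained from the other by a sequence of transpositions of adjacent commuting letters. -/
def CommEquiv {B : Type*} (M : CoxeterMatrix B) : List B → List B → Prop :=
  Relation.EqvGen (CommMove M)

/-- An element is fully commutative if all its reduced words are commutation-equivalent. -/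
def IsFullyCommutative {B W : Type*} [Group W] {M : CoxeterMatrix B}
    (cs : CoxeterSystem M W) (w : W) : Prop :=
  ∀ u v : List B, cs.IsReduced u → cs.wordProd u = w →
    cs.IsReduced v → cs.wordProd v = w → CommEquiv M u v

/-- A fully commutative involution (the identity is allowed). -/
def IsFCInvolution {B W : Type*} [Group W] {M : CoxeterMatrix B}
    (cs : CoxeterSystem M W) (w : W) : Prop :=
  IsFullyCommutative cs w ∧ w * w = 1

/-- The Coxeter matrix of type `D_{n+1}`: generators `s_1, …, s_{n+1}` (index `k : Fin (n+1)`
corresponds to `s_{k+1}`), with `m(s_i, s_{i+1}) = 3` for `1 ≤ i ≤ n-1`,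
`m(s_{n-1}, s_{n+1}) = 3`, `m(s_n, s_{n+1}) = 2`, and `m(s_i, s_j) = 2` for all
other pairs `i ≠ j`. -/
def typeD (n : ℕ) : CoxeterMatrix (Fin (n + 1)) where
  M := Matrix.of fun i j : Fin (n + 1) =>
    if (i : ℕ) = (j : ℕ) then 1
    else if ((i : ℕ) + 1 = (j : ℕ) ∧ (j : ℕ) < n) ∨ ((j : ℕ) + 1 = (i : ℕ) ∧ (i : ℕ) < n)
        ∨ ((i : ℕ) + 2 = n ∧ (j : ℕ) = n) ∨ ((j : ℕ) + 2 = n ∧ (i : ℕ) = n) then 3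
    else 2
  isSymm := by
    ext i j
    simp only [Matrix.transpose_apply, Matrix.of_apply]
    split_ifs <;> omega
  diagonal := by intro i; simp [Matrix.of_apply]
  off_diagonal := by
    intro i j hij
    have h : (i : ℕ) ≠ (j : ℕ) := fun h => hij (Fin.ext h)
    simp only [Matrix.of_apply]
    split_ifs <;> omega

/-- The right descent set of `w`, as a finset of indices: those `i` with
`ℓ(w sᵢ) < ℓ(w)`. -/
noncomputable def rightDescents {n : ℕ} {W : Type*} [Group W] {M : CoxeterMatrix (Fin n)}
    (cs : CoxeterSystem M W) (w : W) : Finset (Fin n) :=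
  Finset.univ.filter fun i => cs.length (w * cs.simple i) < cs.length w

/-- The major index of `w`: the sum of the labels of its right descents, where the
index `k : Fin n` corresponds to the generator `s_{k+1}` (hence has label `k + 1`). -/
noncomputable def majorIndex {n : ℕ} {W : Type*} [Group W] {M : CoxeterMatrix (Fin n)}
    (cs : CoxeterSystem M W) (w : W) : ℕ :=
  ∑ i ∈ rightDescents cs w, ((i : ℕ) + 1)

/-- The Gaussian binomial coefficient `[n choose k]_q` as a polynomial in `q = X` over `ℚ`,
defined via the `q`-Pascal recursion `[n+1 choose k+1]_q = [n choose k]_q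
+ q^(k+1) · [n choose k+1]_q`; equivalently, it is the generating polynomial
`Σ_λ q^|λ|` over integer partitions `λ` fitting in a `k × (n-k)` box. -/
noncomputable def qbinomQ : ℕ → ℕ → Polynomial ℚ
  | _, 0 => 1
  | 0, _ + 1 => 0
  | n + 1, k + 1 => qbinomQ n k + Polynomial.X ^ (k + 1) * qbinomQ n (k + 1)

/-- The polynomial `P_n(q) ∈ ℚ[q]`: for `n` even,
`P_n(q) = Σ_{h=1}^{n-1} q^h Σ_{i=0}^{h-1} [h-1 choose i]_q
+ (1/2)q^n(1+q) Σ_{i=0}^{n-1} [n-1 choose i]_q`, and for `n` odd there are two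
additional summands `Σ_{h=1}^{(n-1)/2} q^{n-h} [n-h-1 choose (n-1)/2]_q
+ (1/2)q^n(1+q)[n-1 choose (n-1)/2]_q`. -/
noncomputable def Pn (n : ℕ) : Polynomial ℚ :=
  (∑ h ∈ Finset.Icc 1 (n - 1), Polynomial.X ^ h * ∑ i ∈ Finset.range h, qbinomQ (h - 1) i) +
  Polynomial.C (1 / 2 : ℚ) * Polynomial.X ^ n * (1 + Polynomial.X) *
    (∑ i ∈ Finset.range n, qbinomQ (n - 1) i) +
  (if Even n then 0 else
    (∑ h ∈ Finset.Icc 1 ((n - 1) / 2),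
        Polynomial.X ^ (n - h) * qbinomQ (n - h - 1) ((n - 1) / 2)) +
    Polynomial.C (1 / 2 : ℚ) * Polynomial.X ^ n * (1 + Polynomial.X) *
      qbinomQ (n - 1) ((n - 1) / 2))

/-! ### The exchange property for simply laced Coxeter systems -/

/-- A Coxeter matrix is simply laced if distinct generators have product of order two or three. -/
def IsSimplyLaced {B : Type*} (M : CoxeterMatrix B) : Prop :=
  ∀ i j, i ≠ j → M i j = 2 ∨ M i j = 3

section Exchange

variable {B W : Type*} [Group W] {M : CoxeterMatrix B}

open Classical in
/-- The indicator of equality, with values in `ZMod 2`. -/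
noncomputable def eqIndicator (t s : W) : ZMod 2 := if t = s then 1 else 0

/-- Conjugation by `s`, recording in the second coordinate the parity of the visits to `s`. -/
noncomputable def signedConj (s : W) : Function.End (W × ZMod 2) :=
  fun p => (s * p.1 * s, p.2 + eqIndicator p.1 s)

theorem mul_mul_eq_iff_of_mul_self {a : W} (ha : a * a = 1) (t s : W) :
    a * t * a = s ↔ t = a * s * a := by
  have h : a⁻¹ = a := inv_eq_of_mul_eq_one_left ha
  constructor
  · rintro rfl
    calc t = a * a * t * (a * a) := by rw [ha]; simp
      _ = _ := by group
  · rintro rfl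
    calc _ = a * a * s * (a * a) := by group
      _ = _ := by rw [ha]; simp

theorem eqIndicator_conj {a : W} (ha : a * a = 1) (t s : W) :
    eqIndicator (a * t * a) s = eqIndicator t (a * s * a) := by
  classical
  simp only [eqIndicator, mul_mul_eq_iff_of_mul_self ha]

theorem signedConj_mul_self {a : W} (ha : a * a = 1) : signedConj a * signedConj a = 1 := by
  funext ⟨t, e⟩
  change signedConj a (signedConj a (t, e)) = (t, e)
  simp only [signedConj, eqIndicator_conj ha, ha, one_mul]
  refine Prod.ext ?_ ?_
  · calc _ = a * a * t * (a * a) := by simp only [mul_assoc]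
      _ = _ := by rw [ha]; simp
  · simp only [add_assoc, CharTwo.add_self_eq_zero, add_zero]

theorem signedConj_pow_two {a b : W} (ha : a * a = 1) (hb : b * b = 1) (h : (a * b) ^ 2 = 1) :
    (signedConj a * signedConj b) ^ 2 = 1 := by
  have hab : b * a * b = a := by
    rw [mul_mul_eq_iff_of_mul_self hb]
    calc a = a * (b * b) := by rw [hb, mul_one]
      _ = (a * b) ^ 2 * (b * a * b) := by
        rw [pow_two]
        simp only [mul_assoc]
        rw [← mul_assoc b b, hb, one_mul, ← mul_assoc a a, ha, one_mul, hb, mul_one]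
      _ = _ := by rw [h, one_mul]
  have hba : a * b * a = b := by
    calc a * b * a = a * b * a * (b * b) := by rw [hb, mul_one]
      _ = (a * b) ^ 2 * b := by rw [pow_two]; group
      _ = b := by rw [h, one_mul]
  funext ⟨t, e⟩
  rw [pow_two]
  change signedConj a (signedConj b (signedConj a (signedConj b (t, e)))) = (t, e)
  simp only [signedConj, eqIndicator_conj ha, eqIndicator_conj hb, hab, hba, ha, hb, one_mul]
  refine Prod.ext ?_ ?_
  · calc _ = (a * b) ^ 2 * t * (b * a * b * a) := by rw [pow_two]; group
      _ = _ := by rw [h, hab, ha]; simp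
  · dsimp only
    generalize eqIndicator t a = x
    generalize eqIndicator t b = y
    revert e x y
    decide

theorem signedConj_pow_three {a b : W} (ha : a * a = 1) (hb : b * b = 1) (h : (a * b) ^ 3 = 1) :
    (signedConj a * signedConj b) ^ 3 = 1 := by
  have hab : a * (b * a * b) * a = b := by
    have : a * (b * a * b) * a * b = 1 := by
      rw [← h, pow_succ, pow_two]; simp only [mul_assoc]
    calc _ = a * (b * a * b) * a * b * b := by rw [mul_assoc _ b b, hb, mul_one]
      _ = b := by rw [this, one_mul]
  have haba : a * b * a = b * a * b := by
    rw [mul_mul_eq_iff_of_mul_self ha, hab]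
  funext ⟨t, e⟩
  rw [pow_succ, pow_two]
  change signedConj a (signedConj b (signedConj a (signedConj b (signedConj a (signedConj b
    (t, e)))))) = (t, e)
  have hb3 : b * b * b = b := by rw [hb, one_mul]
  have hbb : b * (b * a * b) * b = a := by
    rw [mul_mul_eq_iff_of_mul_self hb]
  simp only [signedConj, eqIndicator_conj ha, eqIndicator_conj hb, haba, hab,
    hbb, ha, hb, one_mul]
  refine Prod.ext ?_ ?_
  · calc _ = (a * b) ^ 3 * t * (b * (a * b * a) * b * a) := by
          rw [pow_succ, pow_two]; simp only [mul_assoc]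
      _ = _ := by rw [h, haba, hbb, ha]; simp
  · dsimp only
    generalize eqIndicator t a = x
    generalize eqIndicator t b = y
    generalize eqIndicator t (b * a * b) = z
    revert e x y z
    decide

variable (cs : CoxeterSystem M W)

theorem isLiftable_signedConj (hM : IsSimplyLaced M) :
    M.IsLiftable (fun i => signedConj (cs.simple i)) := by
  intro i j
  have hp := cs.simple_mul_simple_pow i j
  by_cases hij : i = j
  · subst hij
    rw [M.diagonal, pow_one]
    exact signedConj_mul_self (cs.simple_mul_simple_self i)
  · rcases hM i j hij with h | h <;> rw [h] at hp ⊢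
    · exact signedConj_pow_two (cs.simple_mul_simple_self i) (cs.simple_mul_simple_self j) hp
    · exact signedConj_pow_three (cs.simple_mul_simple_self i) (cs.simple_mul_simple_self j) hp

open Classical in
theorem lift_signedConj_wordProd (hM : IsSimplyLaced M) (ω : List B) (t : W) (e : ZMod 2) :
    cs.lift ⟨_, isLiftable_signedConj cs hM⟩ (cs.wordProd ω) (t, e) =
      (cs.wordProd ω * t * (cs.wordProd ω)⁻¹, e + ((cs.rightInvSeq ω).count t : ZMod 2)) := by
  induction ω with
  | nil =>
    rw [cs.wordProd_nil, map_one]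
    simp [Function.End.one_def]
  | cons i ω ih =>
    rw [cs.wordProd_cons, map_mul, cs.lift_apply_simple]
    change signedConj (cs.simple i) (cs.lift ⟨_, isLiftable_signedConj cs hM⟩ (cs.wordProd ω)
      (t, e)) = _
    rw [ih]
    simp only [signedConj, CoxeterSystem.rightInvSeq, List.count_cons, mul_inv_rev,
      cs.inv_simple]
    refine Prod.ext ?_ ?_
    · simp only [mul_assoc]
    · have : cs.wordProd ω * t * (cs.wordProd ω)⁻¹ = cs.simple i ↔
          (cs.wordProd ω)⁻¹ * cs.simple i * cs.wordProd ω = t := by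
        constructor
        · intro h; rw [← h]; group
        · intro h; rw [← h]; group
      simp only [eqIndicator, this, beq_iff_eq]
      push_cast
      ring

open Classical in
theorem exists_eraseIdx_of_isRightDescent (hM : IsSimplyLaced M) (ω : List B) (i : B)
    (h : cs.IsRightDescent (cs.wordProd ω) i) :
    ∃ j < ω.length, cs.wordProd ω * cs.simple i = cs.wordProd (ω.eraseIdx j) := by
  obtain ⟨ω', hω', hw⟩ := cs.exists_isReduced (cs.wordProd ω * cs.simple i)
  have hprod : cs.wordProd (ω'.concat i) = cs.wordProd ω := by
    rw [cs.wordProd_concat, ← hw, cs.simple_mul_simple_cancel_right]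
  have hred : cs.IsReduced (ω'.concat i) := by
    have h1 := (cs.isRightDescent_iff).1 h
    have h2 : cs.length (cs.wordProd ω') = ω'.length := hω'
    rw [CoxeterSystem.IsReduced, hprod, ← h1, hw, h2]
    simp
  have hcount : (cs.rightInvSeq (ω'.concat i)).count (cs.simple i) = 1 := by
    refine List.count_eq_one_of_mem hred.nodup_rightInvSeq ?_
    rw [cs.rightInvSeq_concat]
    simp
  have h1 := lift_signedConj_wordProd cs hM ω (cs.simple i) 0
  have h2 := lift_signedConj_wordProd cs hM (ω'.concat i) (cs.simple i) 0
  rw [hprod, h1, hcount] at h2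
  have h3 := congrArg Prod.snd h2
  simp only [zero_add, Nat.cast_one] at h3
  have hmem : cs.simple i ∈ cs.rightInvSeq ω := by
    by_contra hn
    rw [List.count_eq_zero_of_not_mem hn] at h3
    simp at h3
  obtain ⟨j, hj, hje⟩ := List.mem_iff_getElem.1 hmem
  have hj' : j < ω.length := by simpa using hj
  refine ⟨j, hj', ?_⟩
  rw [← cs.wordProd_mul_getD_rightInvSeq, List.getD_eq_getElem _ _ hj, hje]

/-- The action of a generator in the numbers game. -/
def numbersGame (M : CoxeterMatrix B) [DecidableEq B] (i : B) : Function.End (B → ℤ) :=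
  fun f j => if j = i then -f i else if M i j = 3 then f j + f i else f j

theorem isLiftable_numbersGame [DecidableEq B] (hM : IsSimplyLaced M) :
    M.IsLiftable (numbersGame M) := by
  intro i j
  by_cases hij : i = j
  · subst hij
    rw [M.diagonal, pow_one]
    funext f k
    change numbersGame M i (numbersGame M i f) k = f k
    simp only [numbersGame]
    split_ifs <;> simp_all
  · have hs := M.symmetric i j
    rcases hM i j hij with h | h
    · rw [h, pow_two]
      funext f k
      change numbersGame M i (numbersGame M j (numbersGame M i (numbersGame M j f))) k = f k
      have hji : M j i = 2 := by rw [← hs, h]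
      simp only [numbersGame, hij, Ne.symm hij, h, hji, if_true, if_false]
      split_ifs <;> simp_all; ring
    · rw [h, pow_succ, pow_two]
      funext f k
      change numbersGame M i (numbersGame M j (numbersGame M i (numbersGame M j
        (numbersGame M i (numbersGame M j f))))) k = f k
      have hji : M j i = 3 := by rw [← hs, h]
      simp only [numbersGame, hij, Ne.symm hij, h, hji, if_true, if_false]
      split_ifs <;> simp_all <;> ring

theorem simple_ne_simple (hM : IsSimplyLaced M) {a b : B} (hab : a ≠ b) :
    cs.simple a ≠ cs.simple b := by
  classical
  intro h
  have h1 := congrArg (cs.lift ⟨_, isLiftable_numbersGame hM⟩) h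
  rw [cs.lift_apply_simple, cs.lift_apply_simple] at h1
  have h2 := congrFun (congrFun h1 (fun j => if j = a then 1 else 0)) a
  simp [numbersGame, hab, hab.symm] at h2

theorem simple_mul_simple_mul_simple_ne (hM : IsSimplyLaced M) {a b : B} (hab : M a b = 3) :
    cs.simple a * cs.simple b * cs.simple a ≠ cs.simple b := by
  classical
  intro h
  have hne : a ≠ b := by rintro rfl; simp at hab
  have hba : M b a = 3 := by rw [M.symmetric, hab]
  have h1 := congrArg (cs.lift ⟨_, isLiftable_numbersGame hM⟩) h
  rw [map_mul, map_mul, cs.lift_apply_simple, cs.lift_apply_simple] at h1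
  have h2 := congrFun (congrFun h1 (fun j => if j = a then 1 else 0)) a
  change numbersGame M a (numbersGame M b (numbersGame M a _)) a = _ at h2
  simp [numbersGame, hne, hne.symm, hab, hba] at h2

theorem length_mul_mul_of_commute (hM : IsSimplyLaced M) {w : W} {a b : B} (hab : a ≠ b)
    (ha : cs.IsRightDescent w a) (hb : cs.IsRightDescent w b) :
    cs.length (w * cs.simple b * cs.simple a) + 2 = cs.length w := by
  obtain ⟨r, hr, hwr⟩ := cs.exists_isReduced (w * cs.simple a)
  have hr' : cs.length (cs.wordProd r) = r.length := hr
  have hla := (cs.isRightDescent_iff).1 ha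
  have hlb := (cs.isRightDescent_iff).1 hb
  have hw : w = cs.wordProd (r ++ [a]) := by
    rw [cs.wordProd_append, ← hwr, cs.wordProd_singleton, cs.simple_mul_simple_cancel_right]
  rw [hw] at hb
  obtain ⟨j, hj, he⟩ := exists_eraseIdx_of_isRightDescent cs hM _ _ hb
  rw [← hw] at he
  rw [List.length_append, List.length_singleton] at hj
  rcases Nat.lt_succ_iff_lt_or_eq.1 hj with hj | rfl
  · rw [List.eraseIdx_append_of_lt_length hj, cs.wordProd_append, cs.wordProd_singleton] at he
    have : w * cs.simple b * cs.simple a = cs.wordProd (r.eraseIdx j) := by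
      rw [he, cs.simple_mul_simple_cancel_right]
    have h1 := cs.length_wordProd_le (r.eraseIdx j)
    rw [← this, List.length_eraseIdx_of_lt hj] at h1
    rw [← hwr] at hr'
    rcases cs.length_mul_simple (w * cs.simple b) a with h | h <;> omega
  · rw [List.eraseIdx_append_of_length_le le_rfl] at he
    simp only [Nat.sub_self, List.eraseIdx_cons_zero, List.append_nil] at he
    rw [← hwr] at he
    exact absurd (mul_left_cancel he) (simple_ne_simple cs hM hab.symm)

theorem length_mul_mul_mul_of_braid (hM : IsSimplyLaced M) {w : W} {a b : B} (hab : M a b = 3)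
    (ha : cs.IsRightDescent w a) (hb : cs.IsRightDescent w b) :
    cs.length (w * cs.simple a * cs.simple b * cs.simple a) + 3 = cs.length w := by
  have hne : a ≠ b := by rintro rfl; simp at hab
  have h2 := length_mul_mul_of_commute cs hM hne.symm hb ha
  have hla := (cs.isRightDescent_iff).1 ha
  have hlb := (cs.isRightDescent_iff).1 hb
  rcases cs.length_mul_simple (w * cs.simple a * cs.simple b) a with h | h
  swap
  · omega
  exfalso
  obtain ⟨r, hr, hwr⟩ := cs.exists_isReduced (w * cs.simple a * cs.simple b)
  have hr' : cs.length (cs.wordProd r) = r.length := hr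
  have hw : w = cs.wordProd (r ++ [b, a]) := by
    rw [cs.wordProd_append, ← hwr, cs.wordProd_cons, cs.wordProd_singleton]
    simp [← mul_assoc]
  rw [hw] at hb
  obtain ⟨j, hj, he⟩ := exists_eraseIdx_of_isRightDescent cs hM _ _ hb
  rw [← hw] at he
  have hpow := cs.simple_mul_simple_pow b a
  rw [M.symmetric, hab] at hpow
  have hbraid :
      cs.simple b * cs.simple a * cs.simple b = cs.simple a * cs.simple b * cs.simple a := by
    rw [← mul_inv_eq_one]
    simp only [mul_inv_rev, cs.inv_simple]
    rw [← hpow, pow_succ, pow_two]; simp only [mul_assoc]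
  rcases lt_or_ge j r.length with hjr | hjr
  · rw [List.eraseIdx_append_of_lt_length hjr, cs.wordProd_append, cs.wordProd_cons,
      cs.wordProd_singleton] at he
    have h4 : w * cs.simple a * cs.simple b * cs.simple a = cs.wordProd (r.eraseIdx j) := by
      have : w * (cs.simple b * cs.simple a * cs.simple b) = cs.wordProd (r.eraseIdx j) := by
        rw [← mul_assoc, ← mul_assoc, he]
        simp [← mul_assoc]
      rw [← this, hbraid]; simp only [mul_assoc]
    have h1 := cs.length_wordProd_le (r.eraseIdx j)
    rw [← h4, List.length_eraseIdx_of_lt hjr] at h1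
    rw [← hwr] at hr'
    omega
  · rw [List.eraseIdx_append_of_length_le hjr] at he
    simp only [List.length_append, List.length_cons, List.length_nil] at hj
    have hj2 : j - r.length = 0 ∨ j - r.length = 1 := by omega
    rcases hj2 with h0 | h0 <;> rw [h0] at he
    · simp only [List.eraseIdx_cons_zero, cs.wordProd_append, cs.wordProd_singleton,
        ← hwr, mul_assoc] at he
      have he2 := (mul_left_cancel he).symm
      rw [← mul_assoc] at he2
      exact simple_mul_simple_mul_simple_ne cs hM hab he2
    · simp only [List.eraseIdx_cons_succ, List.eraseIdx_cons_zero, cs.wordProd_append,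
        cs.wordProd_singleton, ← hwr, cs.simple_mul_simple_cancel_right] at he
      exact simple_ne_simple cs hM hne.symm (mul_left_cancel he)

end Exchange
/-! ### Commutation classes and heaps -/

section Words

variable {B : Type*} {M : CoxeterMatrix B}

namespace CommEquiv

theorem refl (u : List B) : CommEquiv M u u := Relation.EqvGen.refl u

theorem symm {u v : List B} (h : CommEquiv M u v) : CommEquiv M v u := Relation.EqvGen.symm _ _ h

theorem trans {u v w : List B} (h : CommEquiv M u v) (h' : CommEquiv M v w) : CommEquiv M u w :=
  Relation.EqvGen.trans _ _ _ h h'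

theorem lift {r : List B → List B → Prop} (hr : Equivalence r)
    (h : ∀ u v, CommMove M u v → r u v) {u v : List B} (huv : CommEquiv M u v) : r u v := by
  induction huv with
  | rel _ _ hm => exact h _ _ hm
  | refl _ => exact hr.refl _
  | symm _ _ _ ih => exact hr.symm ih
  | trans _ _ _ _ _ ih ih' => exact hr.trans ih ih'

theorem map {f : List B → List B} (h : ∀ u v, CommMove M u v → CommEquiv M (f u) (f v))
    {u v : List B} (huv : CommEquiv M u v) : CommEquiv M (f u) (f v) :=
  lift (r := fun u v => CommEquiv M (f u) (f v))
    ⟨fun _ => refl _, symm, trans⟩ h huv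

theorem eq_of_move {α : Type*} {f : List B → α} (h : ∀ u v, CommMove M u v → f u = f v)
    {u v : List B} (huv : CommEquiv M u v) : f u = f v :=
  lift (r := fun u v => f u = f v) ⟨fun _ => rfl, Eq.symm, Eq.trans⟩ h huv

theorem append_left (x : List B) {u v : List B} (h : CommEquiv M u v) :
    CommEquiv M (x ++ u) (x ++ v) := by
  refine map (f := fun u => x ++ u) ?_ h
  rintro _ _ ⟨p, q, a, b, hab, rfl, rfl⟩
  exact .rel _ _ ⟨x ++ p, q, a, b, hab, by simp, by simp⟩

theorem append_right (x : List B) {u v : List B} (h : CommEquiv M u v) :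
    CommEquiv M (u ++ x) (v ++ x) := by
  refine map (f := fun u => u ++ x) ?_ h
  rintro _ _ ⟨p, q, a, b, hab, rfl, rfl⟩
  exact .rel _ _ ⟨p, q ++ x, a, b, hab, by simp, by simp⟩

theorem cons (a : B) {u v : List B} (h : CommEquiv M u v) : CommEquiv M (a :: u) (a :: v) :=
  h.append_left [a]

theorem reverse {u v : List B} (h : CommEquiv M u v) : CommEquiv M u.reverse v.reverse := by
  refine map (f := List.reverse) ?_ h
  rintro _ _ ⟨p, q, a, b, hab, rfl, rfl⟩
  exact .rel _ _ ⟨q.reverse, p.reverse, b, a, by rw [M.symmetric, hab], by simp, by simp⟩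

theorem perm {u v : List B} (h : CommEquiv M u v) : u.Perm v := by
  refine lift (r := List.Perm) ⟨List.Perm.refl, List.Perm.symm, List.Perm.trans⟩ ?_ h
  rintro _ _ ⟨p, q, a, b, -, rfl, rfl⟩
  exact (List.Perm.swap b a q).append_left p

theorem wordProd_eq {W : Type*} [Group W] (cs : CoxeterSystem M W) {u v : List B}
    (h : CommEquiv M u v) : cs.wordProd u = cs.wordProd v := by
  refine eq_of_move ?_ h
  rintro _ _ ⟨p, q, a, b, hab, rfl, rfl⟩
  have hp := cs.simple_mul_simple_pow a b
  rw [hab, pow_two, mul_eq_one_iff_eq_inv, mul_inv_rev, cs.inv_simple, cs.inv_simple] at hp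
  simp only [cs.wordProd_append, cs.wordProd_cons, ← mul_assoc]
  rw [mul_assoc _ (cs.simple a), hp, ← mul_assoc]

theorem cons_append_singleton {a : B} {x : List B} (hx : ∀ c ∈ x, M a c = 2) :
    CommEquiv M (a :: x) (x ++ [a]) := by
  induction x with
  | nil => exact refl _
  | cons c x ih =>
    refine trans (v := c :: a :: x) ?_ ((ih fun d hd => hx d (by simp [hd])).cons c)
    exact .rel _ _ ⟨[], x, a, c, hx c (by simp), rfl, rfl⟩

theorem erase [DecidableEq B] (a : B) {u v : List B} (h : CommEquiv M u v) :
    CommEquiv M (u.erase a) (v.erase a) := by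
  refine map (f := fun u => u.erase a) ?_ h
  rintro _ _ ⟨p, q, c, d, hcd, rfl, rfl⟩
  have hne : c ≠ d := by rintro rfl; simp at hcd
  by_cases hp : a ∈ p
  · simp only [List.erase_append_left _ hp]
    exact .rel _ _ ⟨_, _, c, d, hcd, rfl, rfl⟩
  · simp only [List.erase_append_right _ hp]
    refine append_left p ?_
    by_cases hc : c = a
    · subst hc
      simp only [List.erase_cons_head,
        List.erase_cons_tail (a := c) (b := d) (by simpa using hne.symm)]
      exact refl _
    · by_cases hd : d = a
      · subst hd
        simp only [List.erase_cons_head,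
          List.erase_cons_tail (a := d) (b := c) (by simpa using hne)]
        exact refl _
      · simp only [List.erase_cons_tail (a := a) (b := c) (by simpa using hc),
          List.erase_cons_tail (a := a) (b := d) (by simpa using hd)]
        exact .rel _ _ ⟨[], _, c, d, hcd, rfl, rfl⟩

theorem of_cons {a : B} {u v : List B} (h : CommEquiv M (a :: u) (a :: v)) : CommEquiv M u v := by
  classical
  simpa using h.erase a

theorem of_append_singleton {a : B} {u v : List B} (h : CommEquiv M (u ++ [a]) (v ++ [a])) :
    CommEquiv M u v := by
  have := h.reverse
  simp only [List.reverse_append, List.reverse_singleton, List.singleton_append] at this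
  simpa using this.of_cons.reverse

end CommEquiv

/-- The indicator function of the neighbours of `a` in the Coxeter graph. -/
def adjIndicator (M : CoxeterMatrix B) (a b : B) : ℕ := if M a b = 3 then 1 else 0

theorem adjIndicator_eq_zero {a b : B} (h : M a b = 2) : adjIndicator M a b = 0 := by
  simp [adjIndicator, h]

/-- A word that is commutation-equivalent to its reversal. -/
def IsSelfDual (M : CoxeterMatrix B) (u : List B) : Prop := CommEquiv M u u.reverse

theorem IsSelfDual.conj {v : List B} (hv : IsSelfDual M v) (i : B) :
    IsSelfDual M (i :: (v ++ [i])) := by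
  simpa [IsSelfDual] using CommEquiv.cons i (CommEquiv.append_right [i] hv)

theorem IsSelfDual.cons {v : List B} (hv : IsSelfDual M v) {i : B} (hi : ∀ c ∈ v, M i c = 2) :
    IsSelfDual M (i :: v) := by
  simpa [IsSelfDual] using
    (CommEquiv.cons i hv).trans (CommEquiv.cons_append_singleton (by simpa using hi))

theorem IsSelfDual.of_commEquiv {u v : List B} (hv : IsSelfDual M v) (h : CommEquiv M u v) :
    IsSelfDual M u :=
  (h.trans hv).trans h.symm.reverse

variable [DecidableEq B]

/-- The total `f`-weight of the letters of a word that precede the first occurrence of `a`. -/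
def weightBefore (f : B → ℕ) (a : B) : List B → ℕ
  | [] => 0
  | c :: v => if c = a then 0 else f c + weightBefore f a v

theorem weightBefore_append_of_mem (f : B → ℕ) {a : B} {x : List B} (hx : a ∈ x) (w : List B) :
    weightBefore f a (x ++ w) = weightBefore f a x := by
  induction x with
  | nil => simp at hx
  | cons c x ih =>
    by_cases hc : c = a
    · simp [weightBefore, hc]
    · have : a ∈ x := by simpa [Ne.symm hc] using hx
      simp [weightBefore, hc, ih this]

theorem weightBefore_append_of_not_mem (f : B → ℕ) {a : B} {x : List B} (hx : a ∉ x)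
    (w : List B) : weightBefore f a (x ++ w) = (x.map f).sum + weightBefore f a w := by
  induction x with
  | nil => simp
  | cons c x ih =>
    simp only [List.mem_cons, not_or] at hx
    simp [weightBefore, Ne.symm hx.1, ih hx.2, add_assoc]

theorem weightBefore_of_not_mem (f : B → ℕ) {a : B} {x : List B} (hx : a ∉ x) :
    weightBefore f a x = (x.map f).sum := by
  simpa [weightBefore] using weightBefore_append_of_not_mem f hx []

theorem weightBefore_append_congr (f : B → ℕ) {a : B} (x : List B) {w w' : List B}
    (h : weightBefore f a w = weightBefore f a w') :
    weightBefore f a (x ++ w) = weightBefore f a (x ++ w') := by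
  by_cases hx : a ∈ x
  · rw [weightBefore_append_of_mem f hx, weightBefore_append_of_mem f hx]
  · rw [weightBefore_append_of_not_mem f hx, weightBefore_append_of_not_mem f hx, h]

theorem weightBefore_append_self (f : B → ℕ) (a : B) (v : List B) :
    weightBefore f a (v ++ [a]) = weightBefore f a v := by
  by_cases hv : a ∈ v
  · rw [weightBefore_append_of_mem f hv]
  · rw [weightBefore_append_of_not_mem f hv, weightBefore_of_not_mem f hv]
    simp [weightBefore]

theorem weightBefore_swap {f : B → ℕ} {a c d : B} (hf : ∀ b, M a b = 2 → f b = 0)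
    (hcd : M c d = 2) (z : List B) :
    weightBefore f a (c :: d :: z) = weightBefore f a (d :: c :: z) := by
  have hdc : M d c = 2 := by rw [M.symmetric, hcd]
  simp only [weightBefore]
  split_ifs with h1 h2 h2
  · rfl
  · subst h1; simp [hf d hcd]
  · subst h2; simp [hf c hdc]
  · omega

theorem CommEquiv.weightBefore_eq {f : B → ℕ} {a : B} (hf : ∀ b, M a b = 2 → f b = 0)
    {u v : List B} (h : CommEquiv M u v) : weightBefore f a u = weightBefore f a v := by
  refine eq_of_move ?_ h
  rintro _ _ ⟨p, q, c, d, hcd, rfl, rfl⟩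
  exact weightBefore_append_congr f p (weightBefore_swap hf hcd q)

/-- A word is a heap word if any two consecutive occurrences of a letter are separated by at least
two neighbours of that letter. -/
def IsHeapWord (M : CoxeterMatrix B) : List B → Prop
  | [] => True
  | a :: v => IsHeapWord M v ∧ (a ∈ v → 2 ≤ weightBefore (adjIndicator M a) a v)

theorem IsHeapWord.of_append_right (x : List B) {w : List B} (h : IsHeapWord M (x ++ w)) :
    IsHeapWord M w := by
  induction x with
  | nil => exact h
  | cons c x ih => exact ih h.1

theorem isHeapWord_append_swap {c d : B} (hcd : M c d = 2) (p q : List B) :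
    IsHeapWord M (p ++ c :: d :: q) ↔ IsHeapWord M (p ++ d :: c :: q) := by
  have hdc : M d c = 2 := by rw [M.symmetric, hcd]
  have hne : c ≠ d := by rintro rfl; simp at hcd
  induction p with
  | nil =>
    simp [IsHeapWord, weightBefore, hne, hne.symm, adjIndicator_eq_zero hcd,
      adjIndicator_eq_zero hdc]
    tauto
  | cons e p ih =>
    simp only [List.cons_append, IsHeapWord, ih]
    rw [weightBefore_append_congr _ p
      (weightBefore_swap (fun b hb => adjIndicator_eq_zero hb) hcd q)]
    simp [or_left_comm]

theorem CommEquiv.isHeapWord_iff {u v : List B} (h : CommEquiv M u v) :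
    IsHeapWord M u ↔ IsHeapWord M v := by
  refine (eq_of_move (f := IsHeapWord M) ?_ h).to_iff
  rintro _ _ ⟨p, q, c, d, hcd, rfl, rfl⟩
  exact propext (isHeapWord_append_swap hcd p q)

theorem isHeapWord_append_singleton (v : List B) (i : B) :
    IsHeapWord M (v ++ [i]) ↔
      IsHeapWord M v ∧ (i ∈ v → 2 ≤ weightBefore (adjIndicator M i) i v.reverse) := by
  induction v with
  | nil => simp [IsHeapWord]
  | cons a v ih =>
    simp only [List.cons_append, IsHeapWord, ih, List.reverse_cons]
    by_cases hai : a = i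
    · subst hai
      simp only [weightBefore_append_self, List.mem_append, or_true,
        forall_const, List.mem_cons, true_or]
      by_cases hv : a ∈ v
      · simp only [hv, forall_const]; tauto
      · rw [weightBefore_of_not_mem _ hv, weightBefore_of_not_mem _ (by simpa using hv)]
        simp [hv, List.sum_reverse]
    · have h1 : (a ∈ v ++ [i]) ↔ a ∈ v := by simp [hai]
      have h2 : (i ∈ a :: v) ↔ i ∈ v := by simp [Ne.symm hai]
      rw [h1, h2]
      have h3 : (a ∈ v → 2 ≤ weightBefore (adjIndicator M a) a (v ++ [i])) ↔
          (a ∈ v → 2 ≤ weightBefore (adjIndicator M a) a v) :=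
        forall_congr' fun h => by rw [weightBefore_append_of_mem _ h]
      have h4 : (i ∈ v → 2 ≤ weightBefore (adjIndicator M i) i (v.reverse ++ [a])) ↔
          (i ∈ v → 2 ≤ weightBefore (adjIndicator M i) i v.reverse) :=
        forall_congr' fun h => by rw [weightBefore_append_of_mem _ (by simpa using h)]
      rw [h3, h4]
      exact and_right_comm

theorem IsHeapWord.of_append_left {v : List B} (x : List B) (h : IsHeapWord M (v ++ x)) :
    IsHeapWord M v := by
  induction x using List.reverseRecOn with
  | nil => simpa using h
  | append_singleton x a ih =>
    rw [← List.append_assoc, isHeapWord_append_singleton] at h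
    exact ih h.1

theorem eq_append_of_weightBefore_eq_zero (hM : IsSimplyLaced M) {a : B} {u : List B}
    (ha : a ∈ u) (h : weightBefore (adjIndicator M a) a u = 0) :
    ∃ x y, u = x ++ a :: y ∧ ∀ c ∈ x, M a c = 2 := by
  induction u with
  | nil => simp at ha
  | cons c u ih =>
    by_cases hc : c = a
    · exact ⟨[], u, by simp [hc], by simp⟩
    · have ha' : a ∈ u := by simpa [Ne.symm hc] using ha
      simp only [weightBefore, hc, if_false, Nat.add_eq_zero_iff] at h
      obtain ⟨x, y, rfl, hx⟩ := ih ha' h.2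
      refine ⟨c :: x, y, rfl, ?_⟩
      have h3 : M a c ≠ 3 := by simpa [adjIndicator] using h.1
      have h2 : M a c = 2 := (hM a c (Ne.symm hc)).resolve_right h3
      simpa [h2] using hx

/-- A letter can be moved to the front exactly when no neighbour precedes it. -/
theorem exists_commEquiv_cons_iff (hM : IsSimplyLaced M) {a : B} {u : List B} :
    (∃ t, CommEquiv M u (a :: t)) ↔ a ∈ u ∧ weightBefore (adjIndicator M a) a u = 0 := by
  constructor
  · rintro ⟨t, h⟩
    refine ⟨h.perm.mem_iff.2 (by simp), ?_⟩
    rw [h.weightBefore_eq fun b hb => adjIndicator_eq_zero hb]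
    simp [weightBefore]
  · rintro ⟨ha, h⟩
    obtain ⟨x, y, rfl, hx⟩ := eq_append_of_weightBefore_eq_zero hM ha h
    refine ⟨x ++ y, ?_⟩
    simpa using ((CommEquiv.cons_append_singleton hx).append_right y).symm

theorem IsSelfDual.isHeapWord_conj {v : List B} (hv : IsSelfDual M v) (hg : IsHeapWord M v)
    {i : B} (hi : 2 ≤ weightBefore (adjIndicator M i) i v) :
    IsHeapWord M (i :: (v ++ [i])) := by
  refine ⟨(isHeapWord_append_singleton v i).2 ⟨hg, fun _ => ?_⟩, fun _ => ?_⟩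
  · rwa [← hv.weightBefore_eq fun b hb => adjIndicator_eq_zero hb]
  · rwa [weightBefore_append_self]

/-- Peeling an extremal letter off a self-dual heap. -/
theorem IsSelfDual.peel (hM : IsSimplyLaced M) {u : List B} (hu : IsSelfDual M u)
    (hg : IsHeapWord M u) {i : B} (hi : i ∈ u) (h0 : weightBefore (adjIndicator M i) i u = 0) :
    (∃ t, CommEquiv M u (i :: t) ∧ (∀ c ∈ t, M i c = 2) ∧ IsSelfDual M t ∧ IsHeapWord M t) ∨
    ∃ v, CommEquiv M u (i :: (v ++ [i])) ∧ IsSelfDual M v ∧ IsHeapWord M v ∧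
      2 ≤ weightBefore (adjIndicator M i) i v := by
  obtain ⟨t, ht⟩ := (exists_commEquiv_cons_iff hM).2 ⟨hi, h0⟩
  have hrev : CommEquiv M (i :: t) (t.reverse ++ [i]) := by
    simpa using (ht.symm.trans hu).trans ht.reverse
  have h1 : weightBefore (adjIndicator M i) i (t.reverse ++ [i]) = 0 := by
    rw [← hrev.weightBefore_eq fun b hb => adjIndicator_eq_zero hb]
    simp [weightBefore]
  rw [weightBefore_append_self] at h1
  have hgt := ht.isHeapWord_iff.1 hg
  by_cases hit : i ∈ t
  · right
    obtain ⟨t', ht'⟩ := (exists_commEquiv_cons_iff hM).2 ⟨List.mem_reverse.2 hit, h1⟩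
    have ht2 : CommEquiv M t (t'.reverse ++ [i]) := by simpa using ht'.reverse
    have hv := ht.trans (ht2.cons i)
    have hgv := hv.isHeapWord_iff.1 hg
    refine ⟨t'.reverse, hv, ?_, (isHeapWord_append_singleton _ _).1 hgv.1 |>.1, ?_⟩
    · have : CommEquiv M (i :: (t'.reverse ++ [i])) (i :: (t' ++ [i])) := by
        simpa using (hv.symm.trans hu).trans hv.reverse
      simpa [IsSelfDual] using this.of_cons.of_append_singleton
    · have := hgv.2 (by simp)
      rwa [weightBefore_append_self] at this
  · left
    rw [weightBefore_of_not_mem _ (by simpa using hit), List.sum_eq_zero_iff] at h1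
    have hc : ∀ c ∈ t, M i c = 2 := by
      intro c hc
      have := h1 (adjIndicator M i c) (by simpa using ⟨c, hc, rfl⟩)
      refine (hM i c ?_).resolve_right (by simpa [adjIndicator] using this)
      rintro rfl; exact hit hc
    refine ⟨t, ht, hc, ?_, hgt.1⟩
    refine CommEquiv.of_cons (a := i) (hrev.trans ?_)
    exact (CommEquiv.cons_append_singleton (by simpa using hc)).symm

/-- A word which is not a heap word is commutation-equivalent to one with a repeated letter or with
a braid. -/
theorem exists_braid_of_not_isHeapWord (hM : IsSimplyLaced M) {u : List B}
    (hu : ¬ IsHeapWord M u) :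
    ∃ x z a, CommEquiv M u (x ++ a :: a :: z) ∨
      ∃ b, M a b = 3 ∧ CommEquiv M u (x ++ a :: b :: a :: z) := by
  induction u with
  | nil => exact absurd trivial hu
  | cons a v ih =>
    by_cases hv : IsHeapWord M v
    swap
    · obtain ⟨x, z, c, h | ⟨b, hb, h⟩⟩ := ih hv
      · exact ⟨a :: x, z, c, .inl (h.cons a)⟩
      · exact ⟨a :: x, z, c, .inr ⟨b, hb, h.cons a⟩⟩
    simp only [IsHeapWord, hv, true_and, not_forall, not_le] at hu
    obtain ⟨hav, hlt⟩ := hu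
    rcases Nat.lt_succ_iff_lt_or_eq.1 hlt with h0 | h1
    · obtain ⟨x, y, rfl, hx⟩ := eq_append_of_weightBefore_eq_zero hM hav (Nat.lt_one_iff.1 h0)
      refine ⟨x, y, a, .inl ?_⟩
      simpa using (CommEquiv.cons_append_singleton hx).append_right (a :: y)
    · obtain ⟨x, b, y, z, rfl, hab, hx, hy⟩ : ∃ x b y z, v = x ++ b :: (y ++ a :: z) ∧ M a b = 3 ∧
          (∀ c ∈ x, M a c = 2) ∧ ∀ c ∈ y, M a c = 2 := by
        clear hlt ih hv
        induction v with
        | nil => simp at hav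
        | cons c v ih =>
          by_cases hc : c = a
          · simp [weightBefore, hc] at h1
          have ha' : a ∈ v := by simpa [Ne.symm hc] using hav
          simp only [weightBefore, hc, if_false] at h1
          rcases hM a c (Ne.symm hc) with h2 | h3
          · rw [adjIndicator_eq_zero h2, zero_add] at h1
            obtain ⟨x, b, y, z, rfl, hab, hx, hy⟩ := ih ha' h1
            exact ⟨c :: x, b, y, z, rfl, hab, by simpa [h2] using hx, hy⟩
          · have h4 : weightBefore (adjIndicator M a) a v = 0 := by
              simpa [adjIndicator, h3] using h1
            obtain ⟨y, z, rfl, hy⟩ := eq_append_of_weightBefore_eq_zero hM ha' h4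
            exact ⟨[], c, y, z, rfl, h3, by simp, hy⟩
      refine ⟨x, y ++ z, a, .inr ⟨b, hab, ?_⟩⟩
      have e1 := (CommEquiv.cons_append_singleton hx).append_right (b :: (y ++ a :: z))
      have e2 := ((CommEquiv.cons_append_singleton hy).symm.append_right z).append_left
        (x ++ [a, b])
      simp only [List.append_assoc, List.cons_append, List.nil_append] at e1 e2
      exact e1.trans e2

end Words

section FullyCommutative

variable {B W : Type*} [Group W] {M : CoxeterMatrix B} (cs : CoxeterSystem M W)

theorem isReduced_append_singleton {r : List B} {w : W} {i : B}
    (hw : cs.wordProd r * cs.simple i = w) (hl : cs.length w = r.length + 1) :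
    cs.IsReduced (r ++ [i]) := by
  simp [CoxeterSystem.IsReduced, cs.wordProd_append, hw, hl]

variable [DecidableEq B]

theorem IsHeapWord.isReduced_and (hM : IsSimplyLaced M) {u : List B} (hu : IsHeapWord M u) :
    cs.IsReduced u ∧ ∀ v, cs.IsReduced v → cs.wordProd v = cs.wordProd u → CommEquiv M u v := by
  induction hn : u.length generalizing u with
  | zero =>
    obtain rfl := List.length_eq_zero_iff.1 hn
    refine ⟨by simp [CoxeterSystem.IsReduced], fun v hv h => ?_⟩
    have : v.length = 0 := by rw [← hv.eq, h]; simp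
    rw [List.length_eq_zero_iff.1 this]
    exact .refl _
  | succ n ih =>
    obtain ⟨u', a, rfl⟩ : ∃ u' a, u = u' ++ [a] := by
      refine ⟨u.dropLast, u.getLast (by rintro rfl; simp at hn), ?_⟩
      exact (List.dropLast_append_getLast _).symm
    have hn' : u'.length = n := by simpa using hn
    have hu' := (isHeapWord_append_singleton u' a).1 hu |>.1
    obtain ⟨hred, hcl⟩ := ih hu' hn'
    have hpu : cs.wordProd (u' ++ [a]) = cs.wordProd u' * cs.simple a := by
      simp [cs.wordProd_append]
    have hredu : cs.IsReduced (u' ++ [a]) := by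
      rcases cs.length_mul_simple (cs.wordProd u') a with h | h
      · rw [CoxeterSystem.IsReduced, hpu, h, hred.eq]; simp
      · exfalso
        obtain ⟨r, hr, hwr⟩ := cs.exists_isReduced (cs.wordProd u' * cs.simple a)
        have hra : cs.wordProd r * cs.simple a = cs.wordProd u' := by
          rw [← hwr, cs.simple_mul_simple_cancel_right]
        have hlr : cs.length (cs.wordProd u') = r.length + 1 := by
          rw [← h, hwr, hr.eq]
        have h1 := hcl (r ++ [a]) (isReduced_append_singleton cs hra hlr)
          (by simpa [cs.wordProd_append] using hra)
        have h2 := (h1.append_right [a]).isHeapWord_iff.1 hu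
        rw [List.append_assoc] at h2
        have h3 := (h2.of_append_right r).2 (by simp)
        simp [weightBefore] at h3
    refine ⟨hredu, fun v hv hvu => ?_⟩
    have hlv : v.length = n + 1 := by rw [← hv.eq, hvu, hredu.eq, hn]
    obtain ⟨v', b, rfl⟩ : ∃ v' b, v = v' ++ [b] := by
      refine ⟨v.dropLast, v.getLast (by rintro rfl; simp at hlv), ?_⟩
      exact (List.dropLast_append_getLast _).symm
    have hpv : cs.wordProd (v' ++ [b]) = cs.wordProd v' * cs.simple b := by
      simp [cs.wordProd_append]
    have hlv' : v'.length = n := by simpa using hlv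
    have hv' : cs.IsReduced v' := by simpa using hv.take v'.length
    by_cases hab : a = b
    · subst hab
      refine (hcl v' hv' ?_).append_right [a]
      rw [hpv, hpu] at hvu
      exact mul_right_cancel hvu
    set w := cs.wordProd (u' ++ [a]) with hw
    have hwa : w * cs.simple a = cs.wordProd u' := by
      rw [hpu, cs.simple_mul_simple_cancel_right]
    have hwb : w * cs.simple b = cs.wordProd v' := by
      rw [← hvu, hpv, cs.simple_mul_simple_cancel_right]
    have hlw : cs.length w = n + 1 := by rw [hw, hredu.eq, hn]
    have hda : cs.IsRightDescent w a := by
      rw [CoxeterSystem.IsRightDescent, hwa, hred.eq, hn', hlw]; omega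
    have hdb : cs.IsRightDescent w b := by
      rw [CoxeterSystem.IsRightDescent, hwb, hv'.eq, hlv', hlw]; omega
    have hpow := cs.simple_mul_simple_pow b a
    rcases hM a b hab with h2 | h3
    · have hl := length_mul_mul_of_commute cs hM hab hda hdb
      obtain ⟨r, hr, hwr⟩ := cs.exists_isReduced (w * cs.simple b * cs.simple a)
      rw [hwr, hr.eq, hlw] at hl
      rw [M.symmetric, h2, pow_two, mul_eq_one_iff_eq_inv, mul_inv_rev, cs.inv_simple,
        cs.inv_simple] at hpow
      have hrb : cs.wordProd r * cs.simple b = cs.wordProd u' := by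
        rw [← hwr, ← hwa, mul_assoc w, hpow, ← mul_assoc, cs.simple_mul_simple_cancel_right]
      have hra : cs.wordProd r * cs.simple a = cs.wordProd v' := by
        rw [← hwr, ← hwb, cs.simple_mul_simple_cancel_right]
      have hrbred := isReduced_append_singleton cs hrb (by rw [hred.eq]; omega)
      have e1 := hcl _ hrbred (by simpa [cs.wordProd_append] using hrb)
      have e2 : CommEquiv M (u' ++ [a]) (r ++ [a] ++ [b]) := by
        refine (e1.append_right [a]).trans ?_
        exact .rel _ _ ⟨r, [], b, a, by rw [M.symmetric, h2], by simp, by simp⟩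
      have hgra := (e2.isHeapWord_iff.1 hu).of_append_left
      have e3 := (ih hgra (by simp; omega)).2 v' hv'
        (by rw [← hra]; simp [cs.wordProd_append])
      exact e2.trans (e3.append_right [b])
    · exfalso
      have hl := length_mul_mul_mul_of_braid cs hM h3 hda hdb
      obtain ⟨r, hr, hwr⟩ := cs.exists_isReduced (w * cs.simple a * cs.simple b * cs.simple a)
      rw [hwr, hr.eq, hlw] at hl
      have hrab : cs.wordProd (r ++ [a, b]) = cs.wordProd u' := by
        rw [cs.wordProd_append, ← hwr, ← hwa, cs.wordProd_cons, cs.wordProd_singleton]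
        simp [← mul_assoc]
      have hred' : cs.IsReduced (r ++ [a, b]) := by
        rw [CoxeterSystem.IsReduced, hrab, hred.eq]; simp; omega
      have e1 := hcl _ hred' hrab
      have h5 := (e1.append_right [a]).isHeapWord_iff.1 hu
      rw [List.append_assoc] at h5
      have h6 := (h5.of_append_right r).2 (by simp)
      simp [weightBefore, Ne.symm hab, adjIndicator, h3] at h6

theorem isHeapWord_of_isFullyCommutative (hM : IsSimplyLaced M) {u : List B}
    (hu : cs.IsReduced u) (h : IsFullyCommutative cs (cs.wordProd u)) : IsHeapWord M u := by
  by_contra hn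
  have hlen {v : List B} (e : CommEquiv M u v) : cs.length (cs.wordProd u) = v.length := by
    rw [hu.eq, e.perm.length_eq]
  obtain ⟨x, z, a, e | ⟨b, hab, e⟩⟩ := exists_braid_of_not_isHeapWord hM hn
  · have h1 := hlen e
    have h2 : cs.wordProd u = cs.wordProd (x ++ z) := by
      rw [e.wordProd_eq cs]
      simp [cs.wordProd_append, cs.wordProd_cons]
    have h3 := cs.length_wordProd_le (x ++ z)
    rw [← h2, h1] at h3
    simp at h3
  · have h1 := hlen e
    have hpow := cs.simple_mul_simple_pow a b
    have hbraid : cs.simple a * (cs.simple b * cs.simple a) =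
        cs.simple b * (cs.simple a * cs.simple b) := by
      rw [← mul_inv_eq_one, ← hpow, hab]
      simp only [mul_inv_rev, cs.inv_simple, pow_succ, pow_zero, one_mul, mul_assoc]
    have h2 : cs.wordProd u = cs.wordProd (x ++ b :: a :: b :: z) := by
      rw [e.wordProd_eq cs]
      simp only [cs.wordProd_append, cs.wordProd_cons]
      have := congrArg (· * cs.wordProd z) hbraid
      simp only [mul_assoc] at this
      rw [this]
    have h3 : cs.IsReduced (x ++ b :: a :: b :: z) := by
      rw [CoxeterSystem.IsReduced, ← h2, h1]; simp
    have h4 := e.symm.trans (h u _ hu rfl h3 h2.symm)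
    have h5 := h4.perm.count_eq a
    have hne : b ≠ a := by rintro rfl; simp at hab
    simp [hne] at h5

theorem isFCInvolution_iff (hM : IsSimplyLaced M) (w : W) :
    IsFCInvolution cs w ↔ ∃ u, IsHeapWord M u ∧ IsSelfDual M u ∧ cs.wordProd u = w := by
  constructor
  · rintro ⟨hfc, hinv⟩
    obtain ⟨u, hu, rfl⟩ := cs.exists_isReduced w
    refine ⟨u, isHeapWord_of_isFullyCommutative cs hM hu hfc, ?_, rfl⟩
    refine hfc u u.reverse hu rfl hu.reverse ?_
    rw [cs.wordProd_reverse]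
    exact inv_eq_of_mul_eq_one_left hinv
  · rintro ⟨u, hg, hs, rfl⟩
    obtain ⟨hred, hcl⟩ := hg.isReduced_and cs hM
    refine ⟨fun v v' hv hvu hv' hvu' => (hcl v hv hvu).symm.trans (hcl v' hv' hvu'), ?_⟩
    have := hs.wordProd_eq cs
    rw [cs.wordProd_reverse] at this
    nth_rewrite 1 [this]
    simp

theorem IsHeapWord.isRightDescent_iff (hM : IsSimplyLaced M) {u : List B} (hg : IsHeapWord M u)
    (hs : IsSelfDual M u) (i : B) :
    cs.IsRightDescent (cs.wordProd u) i ↔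
      i ∈ u ∧ weightBefore (adjIndicator M i) i u = 0 := by
  obtain ⟨hred, hcl⟩ := hg.isReduced_and cs hM
  rw [← exists_commEquiv_cons_iff hM]
  constructor
  · intro h
    obtain ⟨r, hr, hwr⟩ := cs.exists_isReduced (cs.wordProd u * cs.simple i)
    have hl := (cs.isRightDescent_iff).1 h
    have hri : cs.wordProd r * cs.simple i = cs.wordProd u := by
      rw [← hwr, cs.simple_mul_simple_cancel_right]
    rw [hwr, hr.eq] at hl
    have e := hcl _ (isReduced_append_singleton cs hri hl.symm)
      (by simpa [cs.wordProd_append] using hri)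
    exact ⟨r.reverse, by simpa using hs.trans e.reverse⟩
  · rintro ⟨t, ht⟩
    have e : CommEquiv M u (t.reverse ++ [i]) := by simpa using hs.trans ht.reverse
    have h1 : cs.wordProd u * cs.simple i = cs.wordProd t.reverse := by
      rw [e.wordProd_eq cs]; simp only [cs.wordProd_append, cs.wordProd_singleton,
        cs.simple_mul_simple_cancel_right]
    have h2 := cs.length_wordProd_le t.reverse
    rw [CoxeterSystem.IsRightDescent, h1, hred.eq, e.perm.length_eq]
    simp only [List.length_append, List.length_singleton]
    omega

end FullyCommutative

/-! ### Letter counts of self-dual heaps of type `D` -/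

section LetterCounts

/-- The letter counts (indexed by the labels `1, …, n + 1`) of the self-dual heaps of type
`D_{n+1}`. -/
structure IsAdmissible (n : ℕ) (c : ℕ → ℕ) : Prop where
  zero : c 0 = 0
  support : ∀ x, n + 1 < x → c x = 0
  chain : ∀ x, x + 2 ≤ n → c x = c (x + 1) + 1 ∨ c (x + 1) = c x + 1 ∨
    (c x = 0 ∧ c (x + 1) = 0) ∨ (c (x + 1) = 2 ∧ (c x = 0 ∨ c x = 2))
  plateau : ∀ x, x + 2 ≤ n → c (x + 1) = 2 → (c x = 0 ∨ c x = 2) →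
    (x + 3 ≤ n → c (x + 2) = 2) ∧ (x + 2 = n → c n = 1 ∧ c (n + 1) = 1)
  fork : (c n = 0 ∧ c (n + 1) = 0 ∧ c (n - 1) ≤ 1) ∨
    (c n = 1 ∧ c (n + 1) = 1 ∧ (c (n - 1) = 0 ∨ c (n - 1) = 2)) ∨
    ((c n = c (n + 1) + 1 ∨ c (n + 1) = c n + 1) ∧
      (c (n - 1) = c n + c (n + 1) + 1 ∨ c (n - 1) + 1 = c n + c (n + 1)))

/-- Adjacency of labels in the Coxeter graph of type `D_{n+1}`, including an additional label `0`
adjacent to `1`. -/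
def LabelAdj (n x y : ℕ) : Prop :=
  (x + 1 = y ∧ y ≤ n) ∨ (y + 1 = x ∧ x ≤ n) ∨ (x + 1 = n ∧ y = n + 1) ∨ (y + 1 = n ∧ x = n + 1)

/-- The number of letters `y` before the first letter `x`, for adjacent labels `x` and `y`, in the
self-dual heap with letter counts `c`. -/
def lead (n : ℕ) (c : ℕ → ℕ) (x y : ℕ) : ℕ :=
  if c x = 0 then c y
  else if x < n ∧ y < n then (if c x < c y ∨ (c x = c y ∧ y < x) then 1 else 0)
  else if x < n then (if c x + 2 = 2 * c y then 1 else 0)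
  else (c y + 2 - 2 * c x) / 2

/-- The number of neighbours of `x` before the first letter `x`. -/
def totalLead (n : ℕ) (c : ℕ → ℕ) (x : ℕ) : ℕ :=
  if x + 1 < n then lead n c x (x - 1) + lead n c x (x + 1)
  else if x + 1 = n then lead n c x (x - 1) + lead n c x n + lead n c x (n + 1)
  else lead n c x (n - 1)

variable {n : ℕ} {c d : ℕ → ℕ} {x : ℕ}

theorem interior_of_two_le_totalLead (hx : x + 3 ≤ n) (hL : 2 ≤ totalLead n d (x + 1)) :
    (d (x + 1) = 0 ∧ 2 ≤ d x + d (x + 2)) ∨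
      (0 < d (x + 1) ∧ d (x + 1) ≤ d x ∧ d (x + 1) < d (x + 2)) := by
  simp only [totalLead, lead, add_tsub_cancel_right, show x + 1 + 1 < n by omega,
    show x + 1 < n by omega, show x < n by omega, if_true, true_and, Nat.add_assoc,
    Nat.reduceAdd, Nat.lt_add_one, and_true] at hL
  split_ifs at hL <;> omega

theorem branch_of_two_le_totalLead (hL : 2 ≤ totalLead (x + 2) d (x + 1)) :
    (d (x + 1) = 0 ∧ 2 ≤ d x + d (x + 2) + d (x + 3)) ∨
      (0 < d (x + 1) ∧ d (x + 1) ≤ d x ∧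
        (d (x + 1) + 2 = 2 * d (x + 2) ∨ d (x + 1) + 2 = 2 * d (x + 3))) ∨
      (d (x + 1) + 2 = 2 * d (x + 2) ∧ d (x + 1) + 2 = 2 * d (x + 3)) := by
  simp [totalLead, lead, Nat.add_assoc] at hL
  split_ifs at hL <;> omega

theorem leaf_of_two_le_totalLead (hx : x = n ∨ x = n + 1) (hL : 2 ≤ totalLead n d x) :
    2 * d x + 2 ≤ d (n - 1) := by
  have h1 : ¬ x + 1 < n := by omega
  have h2 : ¬ x + 1 = n := by omega
  have h3 : ¬ x < n := by omega
  simp only [totalLead, lead, h1, h2, h3, false_and, if_false] at hL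
  split_ifs at hL <;> omega

theorem IsAdmissible.add_two_interior (hd : IsAdmissible n d) (hx : x + 3 ≤ n)
    (hcx : c (x + 1) = d (x + 1) + 2) (hc : ∀ y, y ≠ x + 1 → c y = d y)
    (hL : 2 ≤ totalLead n d (x + 1)) : IsAdmissible n c := by
  obtain ⟨h0, hs, hch, hp, hf⟩ := hd
  have hL' := interior_of_two_le_totalLead hx hL
  clear hL
  have e0 := hc x (by omega)
  have e2 := hc (x + 2) (by omega)
  have a0 := hch x (by omega)
  have a1 := hch (x + 1) (by omega)
  have p0 := hp x (by omega)
  have p1 := hp (x + 1) (by omega)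
  refine ⟨by rw [hc _ (by omega), h0], fun y hy => by rw [hc _ (by omega), hs _ hy], ?_, ?_, ?_⟩
  · intro y hy
    rcases (by omega : y = x ∨ y = x + 1 ∨ (y ≠ x ∧ y ≠ x + 1)) with rfl | rfl | ⟨h1, h2⟩
    · simp only [Nat.add_assoc, Nat.reduceAdd] at *
      clear hc hch hp hf hs
      grind (splits := 30)
    · simp only [Nat.add_assoc, Nat.reduceAdd] at *
      clear hc hch hp hf hs
      grind (splits := 30)
    · rw [hc y h2, hc (y + 1) (by omega)]
      exact hch y hy
  · intro y hy
    rcases (by omega : y + 1 = x ∨ y = x ∨ y = x + 1 ∨ (y + 1 ≠ x ∧ y ≠ x ∧ y ≠ x + 1)) with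
      rfl | rfl | rfl | ⟨h1, h2, h3⟩
    · have a2 := hch y (by omega)
      have p2 := hp y (by omega)
      rw [hc y (by omega), hc (y + 1) (by omega), hc n (by omega), hc (n + 1) (by omega)]
      simp only [Nat.add_assoc, Nat.reduceAdd] at *
      clear hc hch hp hf hs
      grind (splits := 30)
    · rw [hc n (by omega), hc (n + 1) (by omega)]
      clear hc hch hp hf hs
      grind (splits := 30)
    · have e3 := hc (x + 3) (by omega)
      rw [hc n (by omega), hc (n + 1) (by omega)]
      simp only [Nat.add_assoc, Nat.reduceAdd] at *
      clear hc hch hp hf hs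
      grind (splits := 30)
    · rw [hc y h3, hc (y + 1) (by omega), hc (y + 2) (by omega), hc n (by omega),
        hc (n + 1) (by omega)]
      exact hp y hy
  · rw [hc n (by omega), hc (n + 1) (by omega), hc (n - 1) (by omega)]
    exact hf

theorem IsAdmissible.add_two_branch (hd : IsAdmissible (x + 2) d)
    (hcx : c (x + 1) = d (x + 1) + 2) (hc : ∀ y, y ≠ x + 1 → c y = d y)
    (hL : 2 ≤ totalLead (x + 2) d (x + 1)) : IsAdmissible (x + 2) c := by
  obtain ⟨h0, hs, hch, hp, hf⟩ := hd
  have hL' := branch_of_two_le_totalLead hL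
  clear hL
  have e0 := hc x (by omega)
  have e2 := hc (x + 2) (by omega)
  have e3 := hc (x + 3) (by omega)
  have a0 := hch x (by omega)
  have p0 := hp x (by omega)
  simp only [show x + 2 - 1 = x + 1 by omega, Nat.add_assoc, Nat.reduceAdd] at *
  refine ⟨by rw [hc _ (by omega), h0], fun y hy => by rw [hc _ (by omega), hs _ hy], ?_, ?_, ?_⟩
  · intro y hy
    rcases (by omega : y = x ∨ (y ≠ x ∧ y ≠ x + 1)) with rfl | ⟨h1, h2⟩
    · clear hc hch hp hs
      grind (splits := 30)
    · rw [hc y h2, hc (y + 1) (by omega)]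
      exact hch y hy
  · intro y hy
    rcases (by omega : y + 1 = x ∨ y = x ∨ (y + 1 ≠ x ∧ y ≠ x)) with
      rfl | rfl | ⟨h1, h2⟩
    · have a2 := hch y (by omega)
      have p2 := hp y (by omega)
      rw [hc y (by omega), hc (y + 1) (by omega)]
      simp only [Nat.add_assoc, Nat.reduceAdd] at *
      clear hc hch hp hs
      grind (splits := 30)
    · clear hc hch hp hs
      grind (splits := 30)
    · rw [hc y (by omega), hc (y + 1) (by omega), hc (y + 2) (by omega), e2, e3]
      exact hp y hy
  · simp only [show x + 2 - 1 = x + 1 by omega, Nat.add_assoc, Nat.reduceAdd]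
    clear hc hch hp hs
    grind (splits := 30)

theorem IsAdmissible.add_two_leaf (hn : 1 ≤ n) (hd : IsAdmissible n d) (hx : x = n ∨ x = n + 1)
    (hcx : c x = d x + 2) (hc : ∀ y, y ≠ x → c y = d y)
    (hL : 2 ≤ totalLead n d x) : IsAdmissible n c := by
  obtain ⟨h0, hs, hch, hp, hf⟩ := hd
  have hL' := leaf_of_two_le_totalLead hx hL
  clear hL
  refine ⟨by rw [hc _ (by omega), h0], fun y hy => by rw [hc _ (by omega), hs _ hy], ?_, ?_, ?_⟩
  · intro y hy
    rw [hc y (by omega), hc (y + 1) (by omega)]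
    exact hch y hy
  · intro y hy
    have p := hp y hy
    have e := hc (y + 2)
    rw [hc y (by omega), hc (y + 1) (by omega)]
    rcases (by omega : y + 2 = n ∨ y + 2 < n) with rfl | h
    · simp only [show y + 2 - 1 = y + 1 by omega] at *
      rcases hx with rfl | rfl <;> clear hc hch hp hs <;> grind (splits := 30)
    · rw [e (by omega)]
      clear hc hch hp hs
      grind (splits := 30)
  · rw [hc (n - 1) (by omega)]
    rcases hx with rfl | rfl
    · rw [hc (x + 1) (by omega)]
      clear hc hch hp hs
      grind (splits := 30)
    · rw [hc n (by omega)]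
      clear hc hch hp hs
      grind (splits := 30)

theorem IsAdmissible.add_two (hn : 1 ≤ n) (hd : IsAdmissible n d) (hx : 1 ≤ x) (hxn : x ≤ n + 1)
    (hcx : c x = d x + 2) (hc : ∀ y, y ≠ x → c y = d y) (hL : 2 ≤ totalLead n d x) :
    IsAdmissible n c := by
  rcases (by omega : (x = n ∨ x = n + 1) ∨ x + 1 = n ∨ x + 2 ≤ n) with h | rfl | h
  · exact hd.add_two_leaf hn h hcx hc hL
  · obtain ⟨x, rfl⟩ := Nat.exists_eq_add_of_le' hx
    exact hd.add_two_branch hcx hc hL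
  · obtain ⟨x, rfl⟩ := Nat.exists_eq_add_of_le' hx
    exact hd.add_two_interior (by omega) hcx hc hL

theorem lead_self_add_two (hn : 1 ≤ n) (hd : IsAdmissible n d) (hx : 1 ≤ x) (hxn : x ≤ n + 1)
    (hcx : c x = d x + 2) (hc : ∀ y, y ≠ x → c y = d y) (hL : 2 ≤ totalLead n d x) {y : ℕ}
    (hy : LabelAdj n x y) : lead n c x y = 0 := by
  obtain ⟨h0, hs, hch, hp, hf⟩ := hd
  rcases (by omega : (x = n ∨ x = n + 1) ∨ x + 1 = n ∨ x + 2 ≤ n) with h | rfl | h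
  · have hL' := leaf_of_two_le_totalLead h hL
    have : y = n - 1 := by unfold LabelAdj at hy; omega
    subst this
    have h3 : ¬ x < n := by omega
    simp only [lead, hcx, hc (n - 1) (by omega), h3, false_and, if_false]
    rcases h with rfl | rfl <;> grind
  · obtain ⟨x, rfl⟩ := Nat.exists_eq_add_of_le' hx
    have hL' := branch_of_two_le_totalLead hL
    have a0 := hch x (by omega)
    have p0 := hp x (by omega)
    have e0 := hc x (by omega)
    have e2 := hc (x + 2) (by omega)
    have e3 := hc (x + 3) (by omega)
    have hy' : y = x ∨ y = x + 2 ∨ y = x + 3 := by unfold LabelAdj at hy; omega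
    simp only [show x + 2 - 1 = x + 1 by omega, Nat.add_assoc, Nat.reduceAdd] at *
    clear hL hc hch hp hs hy
    rcases hy' with rfl | rfl | rfl <;> simp [lead, hcx, e0, e2, e3] <;> grind (splits := 30)
  · obtain ⟨x, rfl⟩ := Nat.exists_eq_add_of_le' hx
    have hL' := interior_of_two_le_totalLead (by omega) hL
    have hy' : y = x ∨ y = x + 2 := by unfold LabelAdj at hy; omega
    have e0 := hc x (by omega)
    have e2 := hc (x + 2) (by omega)
    have a0 := hch x (by omega)
    have a1 := hch (x + 1) (by omega)
    have p0 := hp x (by omega)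
    have p1 := hp (x + 1) (by omega)
    simp only [Nat.add_assoc, Nat.reduceAdd] at *
    clear hL hc hch hp hs hf hy
    rcases hy' with rfl | rfl <;> simp only [lead] <;> grind (splits := 30)

theorem lead_add_two_self (hn : 1 ≤ n) (hd : IsAdmissible n d) (hx : 1 ≤ x) (hxn : x ≤ n + 1)
    (hcx : c x = d x + 2) (hc : ∀ y, y ≠ x → c y = d y) (hL : 2 ≤ totalLead n d x) {y : ℕ}
    (hy : LabelAdj n x y) : lead n c y x = lead n d y x + if d y = 0 then 2 else 1 := by
  obtain ⟨h0, hs, hch, hp, hf⟩ := hd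
  rcases (by omega : (x = n ∨ x = n + 1) ∨ x + 1 = n ∨ x + 2 ≤ n) with h | rfl | h
  · have hL' := leaf_of_two_le_totalLead h hL
    have : y = n - 1 := by unfold LabelAdj at hy; omega
    subst this
    have h3 : ¬ x < n := by omega
    have h4 : n - 1 < n := by omega
    simp only [lead, hcx, hc (n - 1) (by omega), h3, h4, and_false, if_false, if_true]
    rcases h with rfl | rfl <;> grind
  · obtain ⟨x, rfl⟩ := Nat.exists_eq_add_of_le' hx
    have hL' := branch_of_two_le_totalLead hL
    have a0 := hch x (by omega)
    have p0 := hp x (by omega)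
    have e0 := hc x (by omega)
    have e2 := hc (x + 2) (by omega)
    have e3 := hc (x + 3) (by omega)
    have hy' : y = x ∨ y = x + 2 ∨ y = x + 3 := by unfold LabelAdj at hy; omega
    simp only [show x + 2 - 1 = x + 1 by omega, Nat.add_assoc, Nat.reduceAdd] at *
    clear hL hc hch hp hs hy
    rcases hy' with rfl | rfl | rfl <;> simp [lead, hcx, e0, e2, e3] <;> grind (splits := 30)
  · obtain ⟨x, rfl⟩ := Nat.exists_eq_add_of_le' hx
    have hL' := interior_of_two_le_totalLead (by omega) hL
    have hy' : y = x ∨ y = x + 2 := by unfold LabelAdj at hy; omega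
    have e0 := hc x (by omega)
    have e2 := hc (x + 2) (by omega)
    have a0 := hch x (by omega)
    have a1 := hch (x + 1) (by omega)
    have p0 := hp x (by omega)
    have p1 := hp (x + 1) (by omega)
    simp only [Nat.add_assoc, Nat.reduceAdd] at *
    clear hL hc hch hp hs hf hy
    rcases hy' with rfl | rfl <;> simp only [lead] <;> grind (splits := 30)

theorem IsAdmissible.add_one (hn : 1 ≤ n) (hd : IsAdmissible n d) (hx : 1 ≤ x) (hxn : x ≤ n + 1)
    (hdx : d x = 0) (hcx : c x = 1) (hc : ∀ y, y ≠ x → c y = d y)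
    (h : ∀ y, LabelAdj n x y → d y = 0) : IsAdmissible n c := by
  obtain ⟨h0, hs, hch, hp, hf⟩ := hd
  unfold LabelAdj at h
  refine ⟨by rw [hc _ (by omega), h0], fun y hy => by rw [hc _ (by omega), hs _ hy], ?_, ?_, ?_⟩
  · intro y hy
    have := hch y hy
    rcases (by omega : y = x ∨ y + 1 = x ∨ (y ≠ x ∧ y + 1 ≠ x)) with rfl | rfl | ⟨h1, h2⟩
    · rw [hcx, hc _ (by omega), h (y + 1) (by omega)]
      simp
    · rw [hcx, hc _ (by omega), h y (by omega)]
      simp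
    · rwa [hc _ h1, hc _ h2]
  · intro y hy hy1 hy2
    have h1 : y + 1 ≠ x := by rintro rfl; omega
    have h2 : y ≠ x := by
      rintro rfl
      rw [hc _ h1, h (y + 1) (by omega)] at hy1
      omega
    rw [hc _ h1] at hy1
    rw [hc _ h2] at hy2
    obtain ⟨p1, p2⟩ := hp y hy hy1 hy2
    constructor
    · intro h3
      rw [hc _ (by rintro rfl; have := p1 h3; omega), p1 h3]
    · intro h3
      rw [hc n (by rintro rfl; have := p2 h3; omega),
        hc (n + 1) (by rintro rfl; have := p2 h3; omega)]
      exact p2 h3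
  · have h1 := h (n - 1)
    have h2 := h n
    have h3 := h (n + 1)
    have e1 := hc (n - 1)
    have e2 := hc n
    have e3 := hc (n + 1)
    clear hc hch hp hs h
    rcases (by omega : x = n ∨ x = n + 1 ∨ x + 1 = n ∨ x + 2 ≤ n) with rfl | rfl | rfl | h
    · grind
    · grind
    · simp only [add_tsub_cancel_right] at *
      grind
    · rw [e1 (by omega), e2 (by omega), e3 (by omega)]
      exact hf

theorem lead_eq_zero_of_isolated (hcx : c x = 1)
    (hc : ∀ y, y ≠ x → c y = d y) (h : ∀ y, LabelAdj n x y → d y = 0) {y : ℕ}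
    (hy : LabelAdj n x y) : lead n c x y = 0 := by
  have h1 := h y hy
  have h2 := hc y (by unfold LabelAdj at hy; omega)
  simp only [lead, hcx, h2, h1]
  unfold LabelAdj at hy
  grind

end LetterCounts

section Peel

variable {n : ℕ} {c d : ℕ → ℕ} {x : ℕ}

/-- The data recording that `d` is obtained from `c` by removing the extremal letters `x`. -/
structure IsPeeling (n : ℕ) (c d : ℕ → ℕ) (x : ℕ) : Prop where
  admissible : IsAdmissible n d
  eq_of_ne : ∀ y, y ≠ x → c y = d y
  peel : (c x = d x + 2 ∧ 2 ≤ totalLead n d x) ∨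
    (c x = 1 ∧ d x = 0 ∧ ∀ y, LabelAdj n x y → d y = 0)

theorem IsAdmissible.peel_interior (hc : IsAdmissible n c) (hx : x + 3 ≤ n)
    (hd : ∀ y, y ≠ x + 1 → c y = d y) (hdx : d (x + 1) = c (x + 1) - 2)
    (h1 : c x < c (x + 1)) (h2 : c (x + 2) ≤ c (x + 1)) : IsPeeling n c d (x + 1) := by
  obtain ⟨h0, hs, hch, hp, hf⟩ := hc
  have e0 := hd x (by omega)
  have e2 := hd (x + 2) (by omega)
  have a0 := hch x (by omega)
  have a1 := hch (x + 1) (by omega)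
  have p0 := hp x (by omega)
  have p1 := hp (x + 1) (by omega)
  simp only [Nat.add_assoc, Nat.reduceAdd] at a1 p1
  refine ⟨⟨by rw [← hd _ (by omega), h0], fun y hy => by rw [← hd _ (by omega), hs _ hy],
    ?_, ?_, ?_⟩, hd, ?_⟩
  · intro y hy
    rcases (by omega : y = x ∨ y = x + 1 ∨ (y ≠ x ∧ y ≠ x + 1)) with rfl | rfl | ⟨h1, h2⟩
    · clear hd hch hp hf hs
      grind (splits := 30)
    · clear hd hch hp hf hs
      simp only [Nat.add_assoc, Nat.reduceAdd] at *
      grind (splits := 30)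
    · rw [← hd y h2, ← hd (y + 1) (by omega)]
      exact hch y hy
  · intro y hy
    rcases (by omega : y + 1 = x ∨ y = x ∨ y = x + 1 ∨ (y + 1 ≠ x ∧ y ≠ x ∧ y ≠ x + 1)) with
      rfl | rfl | rfl | ⟨h1, h2, h3⟩
    · have a2 := hch y (by omega)
      have p2 := hp y (by omega)
      rw [← hd y (by omega), ← hd (y + 1) (by omega), ← hd n (by omega), ← hd (n + 1) (by omega)]
      simp only [Nat.add_assoc, Nat.reduceAdd] at *
      clear hd hch hp hs hf
      grind (splits := 30)
    · clear hd hch hp hs hf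
      grind (splits := 30)
    · have e3 := hd (x + 3) (by omega)
      rw [← hd n (by omega), ← hd (n + 1) (by omega)]
      simp only [Nat.add_assoc, Nat.reduceAdd] at *
      clear hd hch hp hs hf
      grind (splits := 30)
    · rw [← hd y h3, ← hd (y + 1) (by omega), ← hd (y + 2) (by omega), ← hd n (by omega),
        ← hd (n + 1) (by omega)]
      exact hp y hy
  · rw [← hd n (by omega), ← hd (n + 1) (by omega), ← hd (n - 1) (by omega)]
    exact hf
  · rcases (by omega : c (x + 1) = 1 ∨ 2 ≤ c (x + 1)) with h | h
    · right
      refine ⟨h, by omega, fun y hy => ?_⟩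
      have hy' : y = x ∨ y = x + 2 := by unfold LabelAdj at hy; omega
      clear hd hch hp hs hf hy
      rcases hy' with rfl | rfl <;> grind (splits := 30)
    · left
      refine ⟨by omega, ?_⟩
      simp only [totalLead, lead, add_tsub_cancel_right, show x + 1 + 1 < n by omega,
        show x + 1 < n by omega, show x < n by omega, if_true, true_and, Nat.add_assoc,
        Nat.reduceAdd, Nat.lt_add_one, and_true]
      clear hd hch hp hs hf
      grind (splits := 30)

theorem IsAdmissible.peel_branch (hc : IsAdmissible (x + 2) c)
    (hd : ∀ y, y ≠ x + 1 → c y = d y) (hdx : d (x + 1) = c (x + 1) - 2)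
    (h1 : c x < c (x + 1)) (h2 : c (x + 2) + c (x + 3) ≤ c (x + 1)) :
    IsPeeling (x + 2) c d (x + 1) := by
  obtain ⟨h0, hs, hch, hp, hf⟩ := hc
  have e0 := hd x (by omega)
  have e2 := hd (x + 2) (by omega)
  have e3 := hd (x + 3) (by omega)
  have a0 := hch x (by omega)
  have p0 := hp x (by omega)
  simp only [show x + 2 - 1 = x + 1 by omega, Nat.add_assoc, Nat.reduceAdd] at *
  refine ⟨⟨by rw [← hd _ (by omega), h0], fun y hy => by rw [← hd _ (by omega), hs _ hy],
    ?_, ?_, ?_⟩, hd, ?_⟩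
  · intro y hy
    rcases (by omega : y = x ∨ (y ≠ x ∧ y ≠ x + 1)) with rfl | ⟨h1, h2⟩
    · clear hd hch hp hs
      grind (splits := 30)
    · rw [← hd y h2, ← hd (y + 1) (by omega)]
      exact hch y hy
  · intro y hy
    rcases (by omega : y + 1 = x ∨ y = x ∨ (y + 1 ≠ x ∧ y ≠ x)) with
      rfl | rfl | ⟨h1, h2⟩
    · have a2 := hch y (by omega)
      have p2 := hp y (by omega)
      rw [← hd y (by omega), ← hd (y + 1) (by omega)]
      simp only [Nat.add_assoc, Nat.reduceAdd] at *
      clear hd hch hp hs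
      grind (splits := 30)
    · clear hd hch hp hs
      grind (splits := 30)
    · rw [← hd y (by omega), ← hd (y + 1) (by omega), ← hd (y + 2) (by omega), ← e2, ← e3]
      exact hp y hy
  · simp only [show x + 2 - 1 = x + 1 by omega, Nat.add_assoc, Nat.reduceAdd]
    clear hd hch hp hs
    grind (splits := 30)
  · rcases (by omega : c (x + 1) = 1 ∨ 2 ≤ c (x + 1)) with h | h
    · right
      refine ⟨h, by omega, fun y hy => ?_⟩
      have hy' : y = x ∨ y = x + 2 ∨ y = x + 3 := by unfold LabelAdj at hy; omega
      clear hd hch hp hs hy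
      rcases hy' with rfl | rfl | rfl <;> grind (splits := 30)
    · left
      refine ⟨by omega, ?_⟩
      clear hd hch hp hs
      simp [totalLead, lead, Nat.add_assoc]
      grind (splits := 30)

theorem IsAdmissible.peel_leaf (hn : 1 ≤ n) (hc : IsAdmissible n c) (hx : x = n ∨ x = n + 1)
    (hd : ∀ y, y ≠ x → c y = d y) (hdx : d x = c x - 2) (h1 : 0 < c x)
    (h2 : c (n - 1) + 2 = 2 * c x) : IsPeeling n c d x := by
  obtain ⟨h0, hs, hch, hp, hf⟩ := hc
  have e := hd (n - 1) (by omega)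
  refine ⟨⟨by rw [← hd _ (by omega), h0], fun y hy => by rw [← hd _ (by omega), hs _ hy],
    ?_, ?_, ?_⟩, hd, ?_⟩
  · intro y hy
    rw [← hd y (by omega), ← hd (y + 1) (by omega)]
    exact hch y hy
  · intro y hy
    have p := hp y hy
    have e2 := hd (y + 2)
    rw [← hd y (by omega), ← hd (y + 1) (by omega)]
    rcases (by omega : y + 2 = n ∨ y + 2 < n) with rfl | h
    · simp only [show y + 2 - 1 = y + 1 by omega] at *
      clear hd hch hp hs
      rcases hx with rfl | rfl <;> grind (splits := 30)
    · rw [← e2 (by omega)]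
      clear hd hch hp hs
      grind (splits := 30)
  · rw [← e]
    rcases hx with rfl | rfl
    · rw [← hd (x + 1) (by omega)]
      clear hd hch hp hs
      grind (splits := 30)
    · rw [← hd n (by omega)]
      clear hd hch hp hs
      grind (splits := 30)
  · have h3 : ¬ x + 1 < n := by omega
    have h4 : ¬ x + 1 = n := by omega
    have h5 : ¬ x < n := by omega
    rcases (by omega : c x = 1 ∨ 2 ≤ c x) with h | h
    · right
      refine ⟨h, by omega, fun y hy => ?_⟩
      obtain rfl : y = n - 1 := by unfold LabelAdj at hy; omega
      omega
    · left
      simp only [totalLead, lead, h3, h4, h5, false_and, if_false]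
      clear hd hch hp hs
      grind (splits := 30)

theorem IsAdmissible.exists_peeling (hn : 1 ≤ n) (hc : IsAdmissible n c) (hne : ∃ y, c y ≠ 0) :
    ∃ x d, 1 ≤ x ∧ x ≤ n + 1 ∧ IsPeeling n c d x := by
  have hex : ∃ i < n, (∀ j < n, c j ≤ c i) ∧ ∀ j < i, c j < c i := by
    obtain ⟨k, hk, hmax⟩ := Finset.exists_max_image (Finset.range n) c ⟨0, by simp; omega⟩
    have hP : ∃ i, i < n ∧ c i = c k := ⟨k, by simpa using hk, rfl⟩
    classical
    obtain ⟨h1, h2⟩ := Nat.find_spec hP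
    have hmax' : ∀ j < n, c j ≤ c (Nat.find hP) := fun j hj => by
      rw [h2]; exact hmax j (by simpa using hj)
    refine ⟨Nat.find hP, h1, hmax', fun j hj => ?_⟩
    refine lt_of_le_of_ne (hmax' j (by omega)) fun h => ?_
    exact Nat.find_min hP hj ⟨by omega, h.trans h2⟩
  obtain ⟨i, hi, hmax, hlt⟩ := hex
  suffices ∃ x, 1 ≤ x ∧ x ≤ n + 1 ∧ IsPeeling n c (Function.update c x (c x - 2)) x by
    obtain ⟨x, h⟩ := this
    exact ⟨x, _, h⟩
  have hup (x y : ℕ) (hy : y ≠ x) : c y = Function.update c x (c x - 2) y := by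
    rw [Function.update_of_ne hy]
  have hus (x : ℕ) : Function.update c x (c x - 2) x = c x - 2 := Function.update_self ..
  have hf := hc.fork
  rcases Nat.eq_zero_or_pos (c i) with h0 | hpos
  · have h1 : c (n - 1) = 0 := by have := hmax (n - 1) (by omega); omega
    have h2 : c n = 1 ∨ c (n + 1) = 1 := by
      by_contra h
      have h3 : c n = 0 ∧ c (n + 1) = 0 := by omega
      obtain ⟨y, hy⟩ := hne
      rcases (by omega : y < n ∨ y = n ∨ y = n + 1 ∨ n + 1 < y) with h4 | rfl | rfl | h4
      · have := hmax y h4; omega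
      · exact hy h3.1
      · exact hy h3.2
      · exact hy (hc.support y h4)
    rcases h2 with h2 | h2
    · exact ⟨n, by omega, by omega, hc.peel_leaf hn (.inl rfl) (hup n) (hus n) (by omega)
        (by omega)⟩
    · exact ⟨n + 1, by omega, by omega, hc.peel_leaf hn (.inr rfl) (hup _) (hus _) (by omega)
        (by omega)⟩
  · obtain ⟨x, rfl⟩ : ∃ x, i = x + 1 :=
      Nat.exists_eq_add_of_le' (Nat.one_le_iff_ne_zero.2 fun h => by
        subst h; have := hc.zero; omega)
    rcases (by omega : x + 3 ≤ n ∨ n = x + 2) with h | rfl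
    · exact ⟨x + 1, by omega, by omega, hc.peel_interior h (hup _) (hus _) (hlt x (by omega))
        (hmax (x + 2) (by omega))⟩
    · simp only [show x + 2 - 1 = x + 1 by omega, Nat.add_assoc, Nat.reduceAdd] at hf
      by_cases hle : c (x + 2) + c (x + 3) ≤ c (x + 1)
      · exact ⟨x + 1, by omega, by omega, hc.peel_branch (hup _) (hus _) (hlt x (by omega)) hle⟩
      · rcases (by omega : c (x + 1) + 2 = 2 * c (x + 2) ∨ c (x + 1) + 2 = 2 * c (x + 3))
          with h | h
        · exact ⟨x + 2, by omega, by omega, hc.peel_leaf hn (.inl rfl) (hup _) (hus _)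
            (by omega) h⟩
        · exact ⟨x + 3, by omega, by omega, hc.peel_leaf hn (.inr rfl) (hup _) (hus _)
            (by omega) h⟩

end Peel

section WordCounts

variable {n : ℕ}

theorem weightBefore_add {B : Type*} [DecidableEq B] (f g : B → ℕ) (a : B) (u : List B) :
    weightBefore (fun b => f b + g b) a u = weightBefore f a u + weightBefore g a u := by
  induction u with
  | nil => rfl
  | cons c u ih =>
    simp only [weightBefore, ih]
    split_ifs <;> omega

theorem isSimplyLaced_typeD (n : ℕ) : IsSimplyLaced (typeD n) := by
  intro i j hij
  have h : (i : ℕ) ≠ (j : ℕ) := fun h => hij (Fin.ext h)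
  simp only [typeD, Matrix.of_apply, h, if_false]
  split_ifs <;> simp

theorem typeD_eq_three_iff (i j : Fin (n + 1)) :
    typeD n i j = 3 ↔ LabelAdj n (i + 1) (j + 1) := by
  have hi := i.2
  have hj := j.2
  simp only [typeD, Matrix.of_apply, LabelAdj]
  split_ifs <;> omega

/-- The indicator function of the letter with label `y`. -/
def labelIndicator (n y : ℕ) (b : Fin (n + 1)) : ℕ := if (b : ℕ) + 1 = y then 1 else 0

/-- The number of letters with label `y` in a word. -/
def labelCount (u : List (Fin (n + 1))) (y : ℕ) : ℕ := (u.map (labelIndicator n y)).sum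

theorem labelCount_cons (i : Fin (n + 1)) (u : List (Fin (n + 1))) (y : ℕ) :
    labelCount (i :: u) y = labelIndicator n y i + labelCount u y := by
  simp [labelCount]

theorem labelCount_append (u v : List (Fin (n + 1))) (y : ℕ) :
    labelCount (u ++ v) y = labelCount u y + labelCount v y := by
  simp [labelCount]

theorem labelCount_pos_iff (i : Fin (n + 1)) (u : List (Fin (n + 1))) :
    0 < labelCount u (i + 1) ↔ i ∈ u := by
  induction u with
  | nil => simp [labelCount]
  | cons a u ih =>
    rw [labelCount_cons, List.mem_cons, ← ih, labelIndicator]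
    simp only [Nat.add_right_cancel_iff, ← Fin.ext_iff, eq_comm (a := a)]
    split_ifs with h <;> simp [h]

theorem CommEquiv.labelCount_eq {u v : List (Fin (n + 1))} (h : CommEquiv (typeD n) u v) :
    labelCount u = labelCount v :=
  funext fun _ => (h.perm.map _).sum_eq

/-- The number of letters with label `y` before the first letter `i`. -/
def wordLead (i : Fin (n + 1)) (y : ℕ) (u : List (Fin (n + 1))) : ℕ :=
  weightBefore (labelIndicator n y) i u

theorem CommEquiv.wordLead_eq {u v : List (Fin (n + 1))} (h : CommEquiv (typeD n) u v)
    {i : Fin (n + 1)} {y : ℕ} (hy : LabelAdj n (i + 1) y) : wordLead i y u = wordLead i y v := by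
  refine h.weightBefore_eq fun b hb => ?_
  rw [labelIndicator, if_neg]
  rintro rfl
  rw [← typeD_eq_three_iff, hb] at hy
  omega

theorem wordLead_of_not_mem {i : Fin (n + 1)} {y : ℕ} {u : List (Fin (n + 1))} (h : i ∉ u) :
    wordLead i y u = labelCount u y :=
  weightBefore_of_not_mem _ h

theorem adjIndicator_typeD (i : Fin (n + 1)) :
    adjIndicator (typeD n) i =
      if (i : ℕ) + 2 < n then fun b => labelIndicator n i b + labelIndicator n (i + 2) b
      else if (i : ℕ) + 2 = n then fun b =>
        (labelIndicator n i b + labelIndicator n n b) + labelIndicator n (n + 1) b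
      else fun b => labelIndicator n (n - 1) b := by
  have hi := i.2
  funext b
  have hb := b.2
  simp only [adjIndicator, typeD_eq_three_iff, LabelAdj, labelIndicator]
  grind

theorem weightBefore_adjIndicator_typeD (hn : 1 ≤ n) {u : List (Fin (n + 1))} {c : ℕ → ℕ}
    (i : Fin (n + 1))
    (h : ∀ y, LabelAdj n (i + 1) y → wordLead i y u = lead n c (i + 1) y) :
    weightBefore (adjIndicator (typeD n) i) i u = totalLead n c (i + 1) := by
  have hi := i.2
  rw [adjIndicator_typeD, totalLead, add_tsub_cancel_right]
  split_ifs with h1 h2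
  · have h3 : LabelAdj n ((i : ℕ) + 1) i := by unfold LabelAdj; omega
    have h4 : LabelAdj n ((i : ℕ) + 1) ((i : ℕ) + 1 + 1) := by unfold LabelAdj; omega
    rw [weightBefore_add, ← h _ h3, ← h _ h4]
    rfl
  · have h3 : LabelAdj n ((i : ℕ) + 1) i := by unfold LabelAdj; omega
    have h4 : LabelAdj n (i + 1) n := by unfold LabelAdj; omega
    have h5 : LabelAdj n (i + 1) (n + 1) := by unfold LabelAdj; omega
    rw [weightBefore_add, weightBefore_add, ← h _ h3, ← h _ h4, ← h _ h5]
    rfl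
  · have h3 : LabelAdj n (i + 1) (n - 1) := by unfold LabelAdj; omega
    rw [← h _ h3]
    rfl

/-- A word realizes the letter counts `c` if it contains `c y` letters `y` and they are interlaced
as prescribed by `lead`. -/
structure Realizes (u : List (Fin (n + 1))) (c : ℕ → ℕ) : Prop where
  count : labelCount u = c
  wordLead_eq : ∀ (i : Fin (n + 1)) (y : ℕ), LabelAdj n (i + 1) y →
    wordLead i y u = lead n c (i + 1) y

theorem Realizes.of_commEquiv {u v : List (Fin (n + 1))} {c : ℕ → ℕ} (hv : Realizes v c)
    (h : CommEquiv (typeD n) u v) : Realizes u c :=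
  ⟨h.labelCount_eq.trans hv.count, fun i y hy => by rw [h.wordLead_eq hy, hv.wordLead_eq i y hy]⟩

theorem Realizes.nil : Realizes ([] : List (Fin (n + 1))) 0 :=
  ⟨rfl, fun _ _ _ => by simp [wordLead, weightBefore, lead]⟩

theorem wordLead_cons_of_ne {i j : Fin (n + 1)} (h : i ≠ j) (y : ℕ) (u : List (Fin (n + 1))) :
    wordLead j y (i :: u) = labelIndicator n y i + wordLead j y u := by
  simp [wordLead, weightBefore, h]

theorem Realizes.conj (hn : 1 ≤ n) {v : List (Fin (n + 1))} {c d : ℕ → ℕ} {i : Fin (n + 1)}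
    (hd : IsAdmissible n d) (hv : Realizes v d) (hL : 2 ≤ totalLead n d (i + 1))
    (hci : c (i + 1) = d (i + 1) + 2) (hc : ∀ y, y ≠ (i : ℕ) + 1 → c y = d y) :
    Realizes (i :: (v ++ [i])) c := by
  have hi := i.2
  refine ⟨funext fun y => ?_, fun j y hy => ?_⟩
  · simp only [labelCount_cons, labelCount_append, hv.count]
    by_cases h : y = (i : ℕ) + 1
    · subst h; simp [labelIndicator, labelCount, hci]; omega
    · rw [hc y h]; simp [labelIndicator, labelCount, Ne.symm h]
  · by_cases hij : i = j
    · subst hij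
      rw [lead_self_add_two hn hd (by omega) (by omega) hci hc hL hy]
      simp [wordLead, weightBefore]
    · have hij' : (j : ℕ) + 1 ≠ i + 1 := fun h => hij (Fin.ext (by omega))
      rw [wordLead_cons_of_ne hij]
      have h1 : wordLead j y (v ++ [i]) =
          wordLead j y v + if j ∈ v then 0 else labelIndicator n y i := by
        split_ifs with hj
        · exact weightBefore_append_of_mem _ hj _
        · rw [wordLead_of_not_mem hj, wordLead_of_not_mem (by simp [hj, Ne.symm hij]),
            labelCount_append]
          simp [labelCount]
      rw [h1, hv.wordLead_eq j y hy]
      simp only [← labelCount_pos_iff, hv.count]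
      by_cases h : y = (i : ℕ) + 1
      · subst h
        rw [lead_add_two_self hn hd (by omega) (by omega) hci hc hL
          (by unfold LabelAdj at *; omega)]
        simp only [labelIndicator, if_true]
        split_ifs <;> omega
      · simp [labelIndicator, Ne.symm h, lead, hc _ h, hc _ hij']

theorem Realizes.cons_isolated {v : List (Fin (n + 1))} {c d : ℕ → ℕ} {i : Fin (n + 1)}
    (hv : Realizes v d) (hdi : d (i + 1) = 0) (hci : c (i + 1) = 1)
    (hc : ∀ y, y ≠ (i : ℕ) + 1 → c y = d y) (h : ∀ y, LabelAdj n (i + 1) y → d y = 0) :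
    Realizes (i :: v) c := by
  refine ⟨funext fun y => ?_, fun j y hy => ?_⟩
  · rw [labelCount_cons, hv.count]
    by_cases h : y = (i : ℕ) + 1
    · subst h; simp [labelIndicator, hci, hdi]
    · rw [hc y h]; simp [labelIndicator, Ne.symm h]
  · by_cases hij : i = j
    · subst hij
      rw [lead_eq_zero_of_isolated hci hc h hy]
      simp [wordLead, weightBefore]
    · have hij' : (j : ℕ) + 1 ≠ i + 1 := fun h => hij (Fin.ext (by omega))
      rw [wordLead_cons_of_ne hij, hv.wordLead_eq j y hy]
      by_cases h' : y = (i : ℕ) + 1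
      · subst h'
        have h1 := h (j + 1) (by unfold LabelAdj at *; omega)
        simp [labelIndicator, lead, hc _ hij', h1, hci, hdi]
      · simp [labelIndicator, Ne.symm h', lead, hc _ h', hc _ hij']

theorem isAdmissible_zero (n : ℕ) : IsAdmissible n 0 := by
  constructor <;> simp

theorem length_of_commEquiv_conj {i : Fin (n + 1)} {u v : List (Fin (n + 1))}
    (h : CommEquiv (typeD n) u (i :: (v ++ [i]))) : u.length = v.length + 2 := by
  simpa using h.perm.length_eq

/-- The letters of a self-dual heap of type `D` are interlaced as determined by their numbers. -/
theorem IsSelfDual.realizes (hn : 1 ≤ n) {u : List (Fin (n + 1))} (hs : IsSelfDual (typeD n) u)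
    (hg : IsHeapWord (typeD n) u) : IsAdmissible n (labelCount u) ∧ Realizes u (labelCount u) := by
  have hM := isSimplyLaced_typeD n
  induction hl : u.length using Nat.strong_induction_on generalizing u with
  | _ l ih =>
  obtain _ | ⟨i, u'⟩ := u
  · exact ⟨isAdmissible_zero n, Realizes.nil⟩
  have hi := i.2
  set u := i :: u' with hu
  rcases hs.peel hM hg (i := i) (by simp [hu]) (by simp [hu, weightBefore]) with
    ⟨t, ht, hc, hst, hgt⟩ | ⟨v, hv, hsv, hgv, hL⟩
  · have hlt : u.length = t.length + 1 := by simpa using ht.perm.length_eq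
    obtain ⟨ha, hr⟩ := ih t.length (by omega) hst hgt rfl
    have hit : i ∉ t := fun h => by simpa using hc i h
    have hti : labelCount t (i + 1) = 0 := by
      by_contra h
      exact hit ((labelCount_pos_iff i t).1 (Nat.pos_of_ne_zero h))
    have e1 : labelCount u (i + 1) = 1 := by
      rw [ht.labelCount_eq, labelCount_cons, hti]; simp [labelIndicator]
    have e2 : ∀ y, y ≠ (i : ℕ) + 1 → labelCount u y = labelCount t y := fun y hy => by
      rw [ht.labelCount_eq, labelCount_cons]; simp [labelIndicator, Ne.symm hy]
    have hnb : ∀ y, LabelAdj n (i + 1) y → labelCount t y = 0 := by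
      intro y hy
      by_contra h
      have hy1 : y ≤ n + 1 := by unfold LabelAdj at hy; omega
      have hy0 : y ≠ 0 := by rintro rfl; exact h ha.zero
      obtain ⟨k, rfl⟩ : ∃ k : Fin (n + 1), y = k + 1 := ⟨⟨y - 1, by omega⟩, by simp; omega⟩
      have hk := hc k ((labelCount_pos_iff k t).1 (Nat.pos_of_ne_zero h))
      rw [← typeD_eq_three_iff, hk] at hy
      omega
    exact ⟨ha.add_one hn (by omega) (by omega) hti e1 e2 hnb,
      (hr.cons_isolated hti e1 e2 hnb).of_commEquiv ht⟩
  · have hlv := length_of_commEquiv_conj hv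
    obtain ⟨ha, hr⟩ := ih v.length (by omega) hsv hgv rfl
    rw [weightBefore_adjIndicator_typeD hn i (hr.wordLead_eq i)] at hL
    have e1 : labelCount u (i + 1) = labelCount v (i + 1) + 2 := by
      rw [hv.labelCount_eq, labelCount_cons, labelCount_append]
      simp [labelIndicator, labelCount]; omega
    have e2 : ∀ y, y ≠ (i : ℕ) + 1 → labelCount u y = labelCount v y := fun y hy => by
      rw [hv.labelCount_eq, labelCount_cons, labelCount_append]
      simp [labelIndicator, labelCount, Ne.symm hy]
    exact ⟨ha.add_two hn (by omega) (by omega) e1 e2 hL,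
      (hr.conj hn ha hL e1 e2).of_commEquiv hv⟩

/-- A self-dual heap of type `D` is determined by its letter counts. -/
theorem commEquiv_of_labelCount_eq (hn : 1 ≤ n) {u v : List (Fin (n + 1))}
    (hu : IsSelfDual (typeD n) u) (hgu : IsHeapWord (typeD n) u) (hv : IsSelfDual (typeD n) v)
    (hgv : IsHeapWord (typeD n) v) (h : labelCount u = labelCount v) :
    CommEquiv (typeD n) u v := by
  have hM := isSimplyLaced_typeD n
  induction hl : u.length using Nat.strong_induction_on generalizing u v with
  | _ l ih =>
  obtain _ | ⟨i, u'⟩ := u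
  · obtain _ | ⟨j, v'⟩ := v
    · exact .refl _
    · have := (labelCount_pos_iff j (j :: v')).2 (by simp)
      rw [← h] at this
      simp [labelCount] at this
  have h0 : weightBefore (adjIndicator (typeD n) i) i (i :: u') = 0 := by simp [weightBefore]
  have hiu : i ∈ i :: u' := by simp
  set u := i :: u'
  have hiv : i ∈ v := by rwa [← labelCount_pos_iff, ← h, labelCount_pos_iff]
  have h0v : weightBefore (adjIndicator (typeD n) i) i v = 0 := by
    rw [weightBefore_adjIndicator_typeD hn i ((hv.realizes hn hgv).2.wordLead_eq i), ← h,
      ← weightBefore_adjIndicator_typeD hn i ((hu.realizes hn hgu).2.wordLead_eq i), h0]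
  have hcount {t : List (Fin (n + 1))} (ht : ∀ c ∈ t, typeD n i c = 2) :
      labelCount t (i + 1) = 0 := by
    by_contra h
    simpa using ht i ((labelCount_pos_iff i t).1 (Nat.pos_of_ne_zero h))
  have h1 := congrFun h (i + 1)
  rcases hu.peel hM hgu hiu h0 with ⟨t, ht, hc, hst, hgt⟩ | ⟨x, hx, hsx, hgx, -⟩ <;>
    rcases hv.peel hM hgv hiv h0v with ⟨t', ht', hc', hst', hgt'⟩ | ⟨x', hx', hsx', hgx', -⟩
  · refine ht.trans (.trans (.cons i (ih t.length ?_ hst hgt hst' hgt' ?_ rfl)) ht'.symm)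
    · have : u.length = t.length + 1 := by simpa using ht.perm.length_eq
      omega
    · funext y
      have := congrFun h y
      rw [ht.labelCount_eq, ht'.labelCount_eq, labelCount_cons, labelCount_cons] at this
      omega
  · rw [ht.labelCount_eq, hx'.labelCount_eq, labelCount_cons, labelCount_cons,
      labelCount_append, hcount hc] at h1
    simp [labelIndicator, labelCount] at h1
  · rw [hx.labelCount_eq, ht'.labelCount_eq, labelCount_cons, labelCount_cons,
      labelCount_append, hcount hc'] at h1
    simp [labelIndicator, labelCount] at h1
  · refine hx.trans (.trans (.cons i (.append_right [i]
      (ih x.length ?_ hsx hgx hsx' hgx' ?_ rfl))) hx'.symm)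
    · have := length_of_commEquiv_conj hx
      omega
    · funext y
      have := congrFun h y
      rw [hx.labelCount_eq, hx'.labelCount_eq, labelCount_cons, labelCount_cons,
        labelCount_append, labelCount_append] at this
      omega

theorem IsAdmissible.exists_isSelfDual (hn : 1 ≤ n) {c : ℕ → ℕ} (hc : IsAdmissible n c) :
    ∃ u : List (Fin (n + 1)), IsSelfDual (typeD n) u ∧ IsHeapWord (typeD n) u ∧
      labelCount u = c := by
  induction hl : ∑ y ∈ Finset.range (n + 2), c y using Nat.strong_induction_on
    generalizing c with
  | _ l ih =>
  by_cases hne : ∃ y, c y ≠ 0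
  swap
  · push Not at hne
    exact ⟨[], .refl _, trivial, funext fun y => by simp [labelCount, hne]⟩
  obtain ⟨x, d, hx, hxn, hd, hcd, hp⟩ := hc.exists_peeling hn hne
  have hlt : ∑ y ∈ Finset.range (n + 2), d y < l := by
    rw [← hl]
    have hxd : d x < c x := by omega
    refine Finset.sum_lt_sum (fun y _ => ?_) ⟨x, by simp; omega, hxd⟩
    by_cases h : y = x
    · subst h; omega
    · exact (hcd y h).ge
  obtain ⟨v, hs, hg, hcount⟩ := ih _ hlt hd rfl
  obtain ⟨i, rfl⟩ : ∃ i : Fin (n + 1), x = i + 1 := ⟨⟨x - 1, by omega⟩, by simp; omega⟩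
  have hr := (hs.realizes hn hg).2
  rw [hcount] at hr
  rcases hp with ⟨hcx, hL⟩ | ⟨hcx, hdx, hnb⟩
  · refine ⟨i :: (v ++ [i]), hs.conj i, hs.isHeapWord_conj hg ?_, (hr.conj hn hd hL hcx hcd).count⟩
    rwa [weightBefore_adjIndicator_typeD hn i (hr.wordLead_eq i)]
  · have hiv : i ∉ v := by rw [← labelCount_pos_iff, hcount, hdx]; simp
    refine ⟨i :: v, hs.cons fun k hk => ?_, ⟨hg, fun h => absurd h hiv⟩,
      (hr.cons_isolated hdx hcx hcd hnb).count⟩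
    refine (isSimplyLaced_typeD n i k ?_).resolve_right fun h => ?_
    · rintro rfl; exact hiv hk
    · have := hnb _ ((typeD_eq_three_iff i k).1 h)
      rw [← labelCount_pos_iff, hcount] at hk
      omega

end WordCounts

/-! ### Major index in terms of letter counts -/

section Transfer

variable {n : ℕ}

/-- The sum of the labels of the descents of the self-dual heap with letter counts `c`. -/
def labelMaj (n : ℕ) (c : ℕ → ℕ) : ℕ :=
  ∑ x ∈ Finset.Icc 1 (n + 1) with 0 < c x ∧ totalLead n c x = 0, x

theorem majorIndex_wordProd (hn : 1 ≤ n) {u : List (Fin (n + 1))}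
    (hs : IsSelfDual (typeD n) u) (hg : IsHeapWord (typeD n) u) :
    majorIndex (typeD n).toCoxeterSystem ((typeD n).toCoxeterSystem.wordProd u) =
      labelMaj n (labelCount u) := by
  have hd (i : Fin (n + 1)) : i ∈ rightDescents (typeD n).toCoxeterSystem
      ((typeD n).toCoxeterSystem.wordProd u) ↔
        0 < labelCount u (i + 1) ∧ totalLead n (labelCount u) (i + 1) = 0 := by
    rw [rightDescents, Finset.mem_filter, labelCount_pos_iff,
      ← weightBefore_adjIndicator_typeD hn i ((hs.realizes hn hg).2.wordLead_eq i),
      ← hg.isRightDescent_iff (typeD n).toCoxeterSystem (isSimplyLaced_typeD n) hs]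
    simp [CoxeterSystem.IsRightDescent]
  refine Finset.sum_nbij (fun i => (i : ℕ) + 1) (fun i hi => ?_) (fun i _ j _ h => ?_)
    (fun x hx => ?_) (fun _ _ => rfl)
  · have := i.2
    rw [hd] at hi
    simp only [Finset.mem_filter, Finset.mem_Icc]
    exact ⟨by omega, hi⟩
  · exact Fin.ext (by simpa using h)
  · simp only [Finset.coe_filter, Finset.mem_Icc, Set.mem_ofPred_eq] at hx
    obtain ⟨x, rfl⟩ : ∃ y, x = y + 1 := ⟨x - 1, by omega⟩
    exact ⟨⟨x, by omega⟩, (hd _).2 hx.2, rfl⟩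

theorem exists_finset_isFCInvolution (hn : 1 ≤ n) {F : Finset (ℕ → ℕ)}
    (hF : ∀ c, c ∈ F ↔ IsAdmissible n c) :
    ∃ S : Finset (typeD n).Group,
      (∀ w, w ∈ S ↔ IsFCInvolution (typeD n).toCoxeterSystem w) ∧
      ∑ w ∈ S, (Polynomial.X : Polynomial ℚ) ^ majorIndex (typeD n).toCoxeterSystem w =
        ∑ c ∈ F, Polynomial.X ^ labelMaj n c := by
  classical
  set cs := (typeD n).toCoxeterSystem
  have hM := isSimplyLaced_typeD n
  have hex (c : ℕ → ℕ) : ∃ u : List (Fin (n + 1)), c ∈ F →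
      IsSelfDual (typeD n) u ∧ IsHeapWord (typeD n) u ∧ labelCount u = c := by
    by_cases hc : c ∈ F
    · obtain ⟨u, hu⟩ := ((hF c).1 hc).exists_isSelfDual hn
      exact ⟨u, fun _ => hu⟩
    · exact ⟨[], fun h => absurd h hc⟩
  choose u hu using hex
  refine ⟨F.image fun c => cs.wordProd (u c), fun w => ?_, ?_⟩
  · rw [isFCInvolution_iff cs hM, Finset.mem_image]
    constructor
    · rintro ⟨c, hc, rfl⟩
      exact ⟨u c, (hu c hc).2.1, (hu c hc).1, rfl⟩
    · rintro ⟨v, hgv, hsv, rfl⟩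
      have hc : labelCount v ∈ F := (hF _).2 (hsv.realizes hn hgv).1
      obtain ⟨hsu, hgu, h⟩ := hu _ hc
      exact ⟨_, hc, (commEquiv_of_labelCount_eq hn hsu hgu hsv hgv h).wordProd_eq cs⟩
  · rw [Finset.sum_image]
    · refine Finset.sum_congr rfl fun c hc => ?_
      obtain ⟨hsu, hgu, h⟩ := hu _ hc
      rw [majorIndex_wordProd hn hsu hgu, h]
    · intro c hc d hd h
      obtain ⟨-, hgu, hcu⟩ := hu _ hc
      obtain ⟨-, hgv, hcv⟩ := hu _ hd
      rw [← hcu, ← hcv]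
      exact ((hgu.isReduced_and cs hM).2 _ (hgv.isReduced_and cs hM).1 h.symm).labelCount_eq

end Transfer

/-! ### Generating functions of letter counts -/

section GeneratingFunction

open Polynomial

/-- The functions satisfying `P` form a finite set, with generating polynomial `p` with respect to
the statistic `wt`. -/
def HasGF (P : (ℕ → ℕ) → Prop) (wt : (ℕ → ℕ) → ℕ) (p : ℚ[X]) : Prop :=
  ∃ F : Finset (ℕ → ℕ), (∀ c, c ∈ F ↔ P c) ∧ ∑ c ∈ F, X ^ wt c = p

variable {P Q : (ℕ → ℕ) → Prop} {wt wt' : (ℕ → ℕ) → ℕ} {p q : ℚ[X]}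

theorem HasGF.congr (h : HasGF P wt p) (hPQ : ∀ c, Q c ↔ P c) (hwt : ∀ c, Q c → wt' c = wt c)
    (hpq : q = p) : HasGF Q wt' q := by
  obtain ⟨F, hF, rfl⟩ := h
  refine ⟨F, fun c => (hF c).trans (hPQ c).symm, ?_⟩
  rw [hpq]
  exact Finset.sum_congr rfl fun c hc => by rw [hwt c ((hPQ c).2 ((hF c).1 hc))]

theorem HasGF.false (h : ∀ c, ¬ P c) : HasGF P wt 0 :=
  ⟨∅, fun c => by simp [h c], rfl⟩

theorem HasGF.or (hP : HasGF P wt p) (hQ : HasGF Q wt q) (hd : ∀ c, P c → ¬ Q c) :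
    HasGF (fun c => P c ∨ Q c) wt (p + q) := by
  classical
  obtain ⟨F, hF, rfl⟩ := hP
  obtain ⟨G, hG, rfl⟩ := hQ
  refine ⟨F ∪ G, fun c => by rw [Finset.mem_union, hF, hG], Finset.sum_union ?_⟩
  exact Finset.disjoint_left.2 fun c h h' => hd c ((hF c).1 h) ((hG c).1 h')

theorem HasGF.exists_lt {P : ℕ → (ℕ → ℕ) → Prop} {p : ℕ → ℚ[X]} (h : ∀ k, HasGF (P k) wt (p k))
    (hd : ∀ c j k, P j c → P k c → j = k) (N : ℕ) :
    HasGF (fun c => ∃ k < N, P k c) wt (∑ k ∈ Finset.range N, p k) := by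
  induction N with
  | zero => exact .false fun c => by simp
  | succ N ih =>
    refine (ih.or (h N) ?_).congr (fun c => ?_) (fun _ _ => rfl) (Finset.sum_range_succ ..)
    · rintro c ⟨k, hk, hc⟩ hc'
      exact hk.ne (hd c _ _ hc hc')
    · simp only [Nat.lt_succ_iff_lt_or_eq, or_and_right, exists_or, exists_eq_left]

theorem HasGF.map (hP : HasGF P wt p) (f g : (ℕ → ℕ) → ℕ → ℕ) (k : ℕ)
    (hf : ∀ d, P d → Q (f d)) (hg : ∀ c, Q c → P (g c)) (hgf : ∀ d, P d → g (f d) = d)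
    (hfg : ∀ c, Q c → f (g c) = c) (hwt : ∀ c, Q c → wt' c = wt (g c) + k) :
    HasGF Q wt' (X ^ k * p) := by
  classical
  obtain ⟨F, hF, rfl⟩ := hP
  refine ⟨F.image f, fun c => ?_, ?_⟩
  · rw [Finset.mem_image]
    constructor
    · rintro ⟨d, hd, rfl⟩
      exact hf d ((hF d).1 hd)
    · exact fun hc => ⟨g c, (hF _).2 (hg c hc), hfg c hc⟩
  · rw [Finset.sum_image, Finset.mul_sum]
    · refine Finset.sum_congr rfl fun d hd => ?_
      have hd' := (hF d).1 hd
      rw [hwt _ (hf d hd'), hgf d hd', pow_add, mul_comm]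
    · intro d hd e he h
      rw [← hgf d ((hF d).1 hd), ← hgf e ((hF e).1 he)]
      exact congrArg g h

/-- The restrictions to the labels `0, …, m` of the letter counts of self-dual heaps of type
`D`. -/
structure IsChainCount (m : ℕ) (c : ℕ → ℕ) : Prop where
  zero : c 0 = 0
  support : ∀ x, m < x → c x = 0
  step : ∀ x, x < m → c x = c (x + 1) + 1 ∨ c (x + 1) = c x + 1 ∨
    (c x = 0 ∧ c (x + 1) = 0) ∨ (c (x + 1) = 2 ∧ (c x = 0 ∨ c x = 2))
  plateau : ∀ x, x + 1 < m → c (x + 1) = 2 → (c x = 0 ∨ c x = 2) → c (x + 2) = 2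

/-- The contribution of the labels less than `m` to the major index. -/
def chainMaj (m : ℕ) (c : ℕ → ℕ) : ℕ :=
  ∑ x ∈ Finset.range m,
    if c (x - 1) < c x ∧ (c (x + 1) < c x ∨ (c x = 2 ∧ c (x + 1) = 2)) then x else 0

theorem chainMaj_congr {m : ℕ} {c d : ℕ → ℕ} (h : ∀ x ≤ m, c x = d x) :
    chainMaj m c = chainMaj m d := by
  refine Finset.sum_congr rfl fun x hx => ?_
  rw [Finset.mem_range] at hx
  rw [h x (by omega), h (x - 1) (by omega), h (x + 1) (by omega)]

theorem isChainCount_succ_iff {m : ℕ} {c : ℕ → ℕ} :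
    IsChainCount (m + 1) c ↔ IsChainCount m (Function.update c (m + 1) 0) ∧
      (c m = c (m + 1) + 1 ∨ c (m + 1) = c m + 1 ∨
        (c m = 0 ∧ c (m + 1) = 0) ∨ (c (m + 1) = 2 ∧ (c m = 0 ∨ c m = 2))) ∧
      (c m = 2 → (c (m - 1) = 0 ∨ c (m - 1) = 2) → c (m + 1) = 2) := by
  have hu (x : ℕ) (hx : x ≤ m) : Function.update c (m + 1) 0 x = c x :=
    Function.update_of_ne (by omega) _ _
  constructor
  · rintro ⟨h0, hs, hst, hp⟩
    refine ⟨⟨by rw [hu 0 (by omega), h0], fun x hx => ?_, fun x hx => ?_, fun x hx => ?_⟩,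
      hst m (by omega), fun h1 h2 => ?_⟩
    · by_cases h : x = m + 1
      · simp [h]
      · rw [Function.update_of_ne h, hs x (by omega)]
    · rw [hu x (by omega), hu (x + 1) (by omega)]
      exact hst x (by omega)
    · rw [hu x (by omega), hu (x + 1) (by omega), hu (x + 2) (by omega)]
      exact hp x (by omega)
    · rcases m with - | m
      · omega
      · exact hp m (by omega) h1 h2
  · rintro ⟨⟨h0, hs, hst, hp⟩, h1, h2⟩
    refine ⟨by rw [← hu 0 (by omega), h0], fun x hx => ?_, fun x hx => ?_, fun x hx => ?_⟩
    · rw [← hs x (by omega), Function.update_of_ne (by omega)]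
    · rcases Nat.lt_succ_iff_lt_or_eq.1 hx with h | rfl
      · have := hst x h
        rwa [hu x (by omega), hu (x + 1) (by omega)] at this
      · exact h1
    · rcases Nat.lt_succ_iff_lt_or_eq.1 hx with h | rfl
      · have := hp x h
        rwa [hu x (by omega), hu (x + 1) (by omega), hu (x + 2) (by omega)] at this
      · exact h2

/-- The chain counts on `0, …, m` with last two values `a` and `h` such that `R a`. -/
def EndsWith (m h : ℕ) (R : ℕ → Prop) (c : ℕ → ℕ) : Prop :=
  IsChainCount m c ∧ c m = h ∧ R (c (m - 1))

theorem HasGF.step {m h v k : ℕ} {R : ℕ → Prop} (hg : HasGF (EndsWith m h R) (chainMaj m) p)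
    (hst : h = v + 1 ∨ v = h + 1 ∨ (h = 0 ∧ v = 0) ∨ (v = 2 ∧ (h = 0 ∨ h = 2)))
    (hp : ∀ a, R a → h = 2 → (a = 0 ∨ a = 2) → v = 2)
    (hk : ∀ a, R a → (if a < h ∧ (v < h ∨ (h = 2 ∧ v = 2)) then m else 0) = k) :
    HasGF (fun c => EndsWith (m + 1) v (· = h) c ∧ R (c (m - 1))) (chainMaj (m + 1))
      (X ^ k * p) := by
  have hu (c : ℕ → ℕ) (a x : ℕ) (hx : x ≤ m) : Function.update c (m + 1) a x = c x :=
    Function.update_of_ne (by omega) _ _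
  refine hg.map (fun d => Function.update d (m + 1) v) (fun c => Function.update c (m + 1) 0) k
    ?_ ?_ ?_ ?_ ?_
  · rintro d ⟨h1, h2, h3⟩
    have e : Function.update d (m + 1) 0 = d := by
      rw [← h1.support (m + 1) (by omega), Function.update_eq_self]
    simp only [EndsWith, isChainCount_succ_iff, Function.update_idem, Function.update_self,
      add_tsub_cancel_right, hu _ _ m le_rfl, hu _ _ (m - 1) (m.sub_le 1), e]
    exact ⟨⟨⟨h1, by rwa [h2], by rw [h2]; exact hp _ h3⟩, trivial, h2⟩, h3⟩
  · rintro c ⟨⟨h1, h2, h3⟩, h4⟩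
    refine ⟨(isChainCount_succ_iff.1 h1).1, ?_, ?_⟩
    · rw [hu _ _ m le_rfl]; exact h3
    · rwa [hu _ _ (m - 1) (m.sub_le 1)]
  · rintro d ⟨h1, -, -⟩
    simp only [Function.update_idem]
    rw [← h1.support (m + 1) (by omega), Function.update_eq_self]
  · rintro c ⟨⟨h1, h2, -⟩, -⟩
    simp only [Function.update_idem]
    rw [← h2, Function.update_eq_self]
  · rintro c ⟨⟨h1, h2, h3⟩, h4⟩
    rw [chainMaj, Finset.sum_range_succ, ← chainMaj, chainMaj_congr (hu c 0)]
    simp only [add_tsub_cancel_right] at h3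
    rw [h3, h2, hk _ h4]

theorem IsChainCount.step_pred {m : ℕ} {c : ℕ → ℕ} (hc : IsChainCount m c) :
    c (m - 1) = c m + 1 ∨ c (m - 1) + 1 = c m ∨ (c (m - 1) = 0 ∧ c m = 0) ∨
      (c m = 2 ∧ (c (m - 1) = 0 ∨ c (m - 1) = 2)) := by
  rcases m with - | m
  · exact .inr (.inr (.inl ⟨hc.zero, hc.zero⟩))
  · have := hc.step m (by omega)
    rw [add_tsub_cancel_right]
    omega

theorem IsChainCount.step_step {m : ℕ} {c : ℕ → ℕ} (hc : IsChainCount (m + 1) c) :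
    c (m - 1) = c m + 1 ∨ c (m - 1) + 1 = c m ∨ (c (m - 1) = 0 ∧ c m = 0) ∨
      (c m = 2 ∧ c (m + 1) = 2 ∧ (c (m - 1) = 0 ∨ c (m - 1) = 2)) := by
  rw [isChainCount_succ_iff] at hc
  have h1 := hc.1.step_pred
  rw [Function.update_of_ne (by omega), Function.update_of_ne (by omega)] at h1
  have h2 := hc.2.2
  omega

theorem endsWith_congr {m : ℕ} {c : ℕ → ℕ} {p q : Prop} (hp : p → IsChainCount m c)
    (hq : q → IsChainCount m c) (h : IsChainCount m c → (p ↔ q)) : p ↔ q :=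
  ⟨fun h1 => (h (hp h1)).1 h1, fun h1 => (h (hq h1)).2 h1⟩

/-- The generating polynomial of the paths from `(0, 0)` to `(m, h)` with steps `(1, ±1)` and, at
height zero, also `(1, 0)`. -/
noncomputable def pathGF (m h : ℕ) : ℚ[X] := if h ≤ m then qbinomQ m ((m - h) / 2) else 0

/-- The generating polynomial of the paths ending with an up step. -/
noncomputable def upGF : ℕ → ℕ → ℚ[X]
  | 0, _ => 0
  | _ + 1, 0 => 0
  | m + 1, h + 1 => pathGF m h

theorem one_sub_mul_qbinomQ_succ_succ (n k : ℕ) :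
    (1 - X ^ (k + 1)) * qbinomQ (n + 1) (k + 1) = (1 - X ^ (n + 1)) * qbinomQ n k := by
  induction n generalizing k with
  | zero => rcases k with - | k <;> simp [qbinomQ]
  | succ n ih =>
    rcases k with - | k
    · have h := ih 0
      simp only [qbinomQ] at h ⊢
      linear_combination X * h
    · have h1 := ih k
      have h2 := ih (k + 1)
      have h3 : qbinomQ (n + 1) (k + 1) = qbinomQ n k + X ^ (k + 1) * qbinomQ n (k + 1) := by
        rw [qbinomQ]
      rw [qbinomQ]
      linear_combination X ^ (k + 2) * h2 + X * h1 - X * (1 - X ^ (n + 1)) * h3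

theorem qbinomQ_add_two_succ (n k : ℕ) :
    qbinomQ (n + 2) (k + 1) =
      qbinomQ (n + 1) (k + 1) + qbinomQ (n + 1) k - (1 - X ^ (n + 1)) * qbinomQ n k := by
  have h := one_sub_mul_qbinomQ_succ_succ n k
  rw [show qbinomQ (n + 2) (k + 1) = _ from qbinomQ.eq_3 ..]
  linear_combination -h

theorem qbinomQ_eq_zero {n k : ℕ} (h : n < k) : qbinomQ n k = 0 := by
  induction n generalizing k with
  | zero =>
    obtain ⟨k, rfl⟩ := Nat.exists_eq_add_one_of_ne_zero h.ne'
    rw [qbinomQ]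
  | succ n ih =>
    obtain ⟨k, rfl⟩ := Nat.exists_eq_add_one_of_ne_zero (Nat.ne_zero_of_lt h)
    rw [qbinomQ, ih (by omega), ih (by omega), mul_zero, add_zero]

theorem qbinomQ_zero_right (n : ℕ) : qbinomQ n 0 = 1 := by
  cases n <;> rw [qbinomQ]

theorem qbinomQ_self (n : ℕ) : qbinomQ n n = 1 := by
  induction n with
  | zero => rw [qbinomQ]
  | succ n ih => rw [qbinomQ, ih, qbinomQ_eq_zero (by omega), mul_zero, add_zero]

theorem qbinomQ_symm {n a b : ℕ} (h : a + b = n) : qbinomQ n a = qbinomQ n b := by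
  induction n using Nat.strong_induction_on generalizing a b with
  | _ n ih =>
    rcases a with - | a
    · rw [qbinomQ_zero_right, show b = n by omega, qbinomQ_self]
    rcases b with - | b
    · rw [qbinomQ_zero_right, show a + 1 = n by omega, qbinomQ_self]
    obtain ⟨n, rfl⟩ : ∃ N, n = N + 2 := ⟨n - 2, by omega⟩
    rw [qbinomQ_add_two_succ, qbinomQ_add_two_succ,
      ih (n + 1) (by omega) (show a + 1 + b = n + 1 by omega),
      ih (n + 1) (by omega) (show a + (b + 1) = n + 1 by omega),
      ih n (by omega) (show a + b = n by omega)]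
    ring

theorem qbinomQ_succ_succ_of_add {n k j : ℕ} (h : k + j = n) :
    qbinomQ (n + 1) (k + 1) = qbinomQ n (k + 1) + X ^ j * qbinomQ n k := by
  rcases j with - | j
  · rw [show n = k by omega, qbinomQ_self, qbinomQ_self, qbinomQ_eq_zero (by omega)]
    ring
  · rw [qbinomQ_symm (show k + 1 + (j + 1) = n + 1 by omega), qbinomQ,
      qbinomQ_symm (show j + (k + 1) = n by omega), qbinomQ_symm (show k + (j + 1) = n by omega)]

theorem pathGF_succ (m h : ℕ) :
    pathGF (m + 1) h = upGF (m + 1) h + (X ^ m * upGF m (h + 1) +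
      (pathGF m (h + 1) - upGF m (h + 1)) + if h = 0 then pathGF m 0 else 0) := by
  rcases m with - | n
  · rcases h with - | - | h <;> simp [pathGF, upGF, qbinomQ_zero_right]
  rcases h with - | h
  · have h1 : pathGF (n + 2) 0 = qbinomQ (n + 2) (n / 2 + 1) := by
      rw [pathGF, if_pos (by omega)]; congr 1; omega
    have h2 : pathGF (n + 1) 0 = qbinomQ (n + 1) (n / 2 + 1) := by
      rw [pathGF, if_pos (by omega)]
      rcases Nat.even_or_odd' n with ⟨t, rfl | rfl⟩
      · exact qbinomQ_symm (by omega)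
      · congr 1; omega
    have h3 : pathGF (n + 1) 1 = qbinomQ (n + 1) (n / 2) := by
      rw [pathGF, if_pos (by omega)]; congr 1
    have h4 : pathGF n 0 = qbinomQ n (n / 2) := by
      rw [pathGF, if_pos (by omega)]; congr 1
    simp only [upGF, if_pos]
    rw [h1, h2, h3, h4, qbinomQ_add_two_succ]
    ring
  · simp only [upGF, Nat.add_eq_zero_iff, one_ne_zero, and_false, if_false]
    unfold pathGF
    rcases lt_or_ge n (h + 1) with hn | hn
    · rw [if_neg (show ¬ h + 1 + 1 ≤ n + 1 by omega), if_neg (show ¬ h + 1 ≤ n by omega),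
        show (n + 1 + 1 - (h + 1)) / 2 = 0 by omega, show (n + 1 - h) / 2 = 0 by omega,
        qbinomQ_zero_right, qbinomQ_zero_right]
      simp
    · rw [if_pos (by omega), if_pos (by omega), if_pos (by omega), if_pos (by omega),
        show (n + 1 + 1 - (h + 1)) / 2 = (n - (h + 1)) / 2 + 1 by omega,
        show (n + 1 - h) / 2 = (n - (h + 1)) / 2 + 1 by omega,
        show (n + 1 - (h + 1 + 1)) / 2 = (n - (h + 1)) / 2 by omega, qbinomQ_add_two_succ]
      ring

theorem hasGF_endsWith (m h : ℕ) :
    HasGF (EndsWith m h fun a => a + 1 = h) (chainMaj m) (upGF m h) ∧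
    HasGF (EndsWith m h fun a => a = h + 1 ∨ (a = 0 ∧ h = 0)) (chainMaj m)
      (pathGF m h - upGF m h) := by
  induction m generalizing h with
  | zero =>
    refine ⟨.false ?_, ?_⟩
    · rintro c ⟨-, h1, h2⟩
      simp only [zero_tsub] at h2
      omega
    · rcases h with - | h
      · refine ⟨{0}, fun c => ?_, by simp [chainMaj, pathGF, upGF, qbinomQ]⟩
        rw [Finset.mem_singleton]
        constructor
        · rintro rfl
          exact ⟨⟨rfl, fun _ _ => rfl, fun _ _ => by simp, fun _ _ => by simp⟩, rfl,
            .inr ⟨rfl, rfl⟩⟩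
        · rintro ⟨h1, -⟩
          funext x
          rcases Nat.eq_zero_or_pos x with rfl | hx
          · exact h1.zero
          · exact h1.support x hx
      · refine (HasGF.false ?_).congr (fun _ => .rfl) (fun _ _ => rfl) (by simp [pathGF, upGF])
        rintro c ⟨h0, h1, -⟩
        rw [h0.zero] at h1
        omega
  | succ m ih =>
    constructor
    · rcases h with - | h
      · exact .false fun c hc => by simpa using hc.2.2
      · have h1 := (ih h).1.step (v := h + 1) (k := 0) (by omega) (by omega)
          (by intro a ha; split_ifs <;> omega)
        have h2 := (ih h).2.step (v := h + 1) (k := 0) (by omega) (by omega)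
          (by intro a ha; split_ifs <;> omega)
        refine (h1.or h2 ?_).congr (fun c => ?_) (fun _ _ => rfl) (by simp [upGF])
        · rintro c ⟨h1, h2⟩ ⟨h3, h4⟩
          omega
        · simp only [EndsWith, add_tsub_cancel_right]
          refine endsWith_congr (m := m + 1) (c := c) (by tauto) (by tauto) fun hc => ?_
          have := hc.step_step
          simp only [hc, true_and]
          omega
    · have h1 := (ih (h + 1)).1.step (v := h) (k := m) (by omega) (by omega)
        (by intro a ha; split_ifs <;> omega)
      have h2 := (ih (h + 1)).2.step (v := h) (k := 0) (by omega) (by omega)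
        (by intro a ha; split_ifs <;> omega)
      have h12 := h1.or h2 (by rintro c ⟨h1, h2⟩ ⟨h3, h4⟩; omega)
      rcases h with - | h
      · have h3 := (ih 0).2.step (v := 0) (k := 0) (by omega) (by omega)
          (by intro a ha; split_ifs <;> omega)
        refine (h12.or h3 ?_).congr (fun c => ?_) (fun _ _ => rfl) ?_
        · rintro c (⟨⟨-, -, h1⟩, -⟩ | ⟨⟨-, -, h1⟩, -⟩) ⟨⟨-, -, h2⟩, -⟩ <;>
            simp only [add_tsub_cancel_right] at h1 h2 <;> omega
        · simp only [EndsWith, add_tsub_cancel_right]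
          refine endsWith_congr (m := m + 1) (c := c) (by tauto) (by tauto) fun hc => ?_
          have := hc.step_step
          simp only [hc, true_and]
          clear ih h1 h2 h12 h3
          grind
        · rw [pathGF_succ, if_pos rfl]
          cases m <;> simp [upGF]
      · refine h12.congr (fun c => ?_) (fun _ _ => rfl) (by rw [pathGF_succ]; simp)
        simp only [EndsWith, add_tsub_cancel_right]
        refine endsWith_congr (m := m + 1) (c := c) (by tauto) (by tauto) fun hc => ?_
        have := hc.step_step
        simp only [hc, true_and]
        omega

end GeneratingFunction

section Fork

open Polynomial

variable {m : ℕ} {c : ℕ → ℕ}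

/-- The generating polynomial of the chain counts ending with at least two values `2` on a
plateau. -/
noncomputable def plateauGF (m : ℕ) : ℚ[X] :=
  ∑ k ∈ Finset.range m, (X ^ k * (upGF k 2 + upGF k 1) + (pathGF k 2 - upGF k 2))

theorem upGF_zero (m : ℕ) : upGF m 0 = 0 := by
  cases m <;> rfl

theorem hasGF_plateau (m : ℕ) :
    HasGF (EndsWith m 2 (· = 0)) (chainMaj m) (upGF m 1) ∧
    HasGF (EndsWith m 2 (· = 2)) (chainMaj m) (plateauGF m) := by
  induction m with
  | zero =>
    constructor <;>
    · refine .false fun c hc => ?_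
      have := hc.1.zero
      have := hc.2.1
      omega
  | succ m ih =>
    constructor
    · have h := (hasGF_endsWith m 0).2.step (v := 2) (k := 0) (by omega) (by omega)
        (by intro a ha; split_ifs <;> omega)
      refine h.congr (fun c => ?_) (fun _ _ => rfl) (by
        rw [upGF_zero, show upGF (m + 1) 1 = pathGF m 0 from rfl]; ring)
      simp only [EndsWith, add_tsub_cancel_right]
      refine endsWith_congr (m := m + 1) (c := c) (by tauto) (by tauto) fun hc => ?_
      have := hc.step_step
      simp only [hc, true_and]
      grind
    · have h1 := (hasGF_endsWith m 2).1.step (v := 2) (k := m) (by omega) (by omega)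
        (by intro a ha; split_ifs <;> omega)
      have h2 := (hasGF_endsWith m 2).2.step (v := 2) (k := 0) (by omega) (by omega)
        (by intro a ha; split_ifs <;> omega)
      have h3 := ih.1.step (v := 2) (k := m) (by omega) (by omega)
        (by intro a ha; split_ifs <;> omega)
      have h4 := ih.2.step (v := 2) (k := 0) (by omega) (by omega)
        (by intro a ha; split_ifs <;> omega)
      refine (((h1.or h2 ?_).or h3 ?_).or h4 ?_).congr (fun c => ?_) (fun _ _ => rfl) ?_
      · rintro c ⟨-, h1⟩ ⟨-, h2⟩
        omega
      · rintro c (⟨-, h1⟩ | ⟨-, h1⟩) ⟨-, h2⟩ <;> omega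
      · rintro c ((⟨-, h1⟩ | ⟨-, h1⟩) | ⟨-, h1⟩) ⟨-, h2⟩ <;> omega
      · simp only [EndsWith, add_tsub_cancel_right]
        refine endsWith_congr (m := m + 1) (c := c) (by tauto) (by tauto) fun hc => ?_
        have := hc.step_step
        simp only [hc, true_and]
        clear ih h1 h2 h3 h4
        grind
      · rw [plateauGF, Finset.sum_range_succ, ← plateauGF]
        ring

/-- The function agreeing with `c` on the labels at most `m` and vanishing on the labels `m + 1`
and `m + 2`. -/
def trim (m : ℕ) (c : ℕ → ℕ) : ℕ → ℕ := Function.update (Function.update c (m + 1) 0) (m + 2) 0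

theorem isAdmissible_succ_iff :
    IsAdmissible (m + 1) c ↔ IsChainCount m (trim m c) ∧
      (c m = 2 → (c (m - 1) = 0 ∨ c (m - 1) = 2) → c (m + 1) = 1 ∧ c (m + 2) = 1) ∧
      ((c (m + 1) = 0 ∧ c (m + 2) = 0 ∧ c m ≤ 1) ∨
        (c (m + 1) = 1 ∧ c (m + 2) = 1 ∧ (c m = 0 ∨ c m = 2)) ∨
        ((c (m + 1) = c (m + 2) + 1 ∨ c (m + 2) = c (m + 1) + 1) ∧
          (c m = c (m + 1) + c (m + 2) + 1 ∨ c m + 1 = c (m + 1) + c (m + 2)))) := by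
  have hu (x : ℕ) (hx : x ≤ m) : trim m c x = c x := by
    rw [trim, Function.update_of_ne (by omega), Function.update_of_ne (by omega)]
  constructor
  · rintro ⟨h0, hs, hch, hp, hf⟩
    refine ⟨⟨by rw [hu 0 (by omega), h0], fun x hx => ?_, fun x hx => ?_, fun x hx => ?_⟩,
      fun h1 h2 => ?_, hf⟩
    · simp only [trim, Function.update_apply]
      split_ifs
      · rfl
      · rfl
      · exact hs x (by omega)
    · rw [hu x (by omega), hu (x + 1) (by omega)]
      exact hch x (by omega)
    · rw [hu x (by omega), hu (x + 1) (by omega), hu (x + 2) (by omega)]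
      exact fun h1 h2 => (hp x (by omega) h1 h2).1 (by omega)
    · rcases m with - | m
      · omega
      · exact (hp m (by omega) h1 h2).2 rfl
  · rintro ⟨⟨h0, hs, hst, hp⟩, hp', hf⟩
    refine ⟨by rw [← hu 0 (by omega), h0], fun x hx => ?_, fun x hx => ?_,
      fun x hx h1 h2 => ⟨fun h3 => ?_, fun h3 => ?_⟩, hf⟩
    · have := hs x (by omega)
      rwa [trim, Function.update_of_ne (by omega), Function.update_of_ne (by omega)] at this
    · have := hst x (by omega)
      rwa [hu x (by omega), hu (x + 1) (by omega)] at this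
    · have := hp x (by omega)
      rw [hu x (by omega), hu (x + 1) (by omega), hu (x + 2) (by omega)] at this
      exact this h1 h2
    · obtain rfl : x + 1 = m := by omega
      exact hp' h1 h2

theorem labelMaj_succ (hc : IsAdmissible (m + 1) c) :
    labelMaj (m + 1) c = chainMaj m c +
      (if c (m - 1) < c m ∧
        (c m = c (m + 1) + c (m + 2) + 1 ∨ (c m = 2 ∧ c (m + 1) = 1 ∧ c (m + 2) = 1))
        then m else 0) +
      (if 0 < c (m + 1) ∧ c m + 2 = 2 * c (m + 1) then m + 1 else 0) +
      (if 0 < c (m + 2) ∧ c m + 2 = 2 * c (m + 2) then m + 2 else 0) := by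
  have hf := (isAdmissible_succ_iff.1 hc).2.2
  have h0 := hc.zero
  have h1 : labelMaj (m + 1) c = ∑ x ∈ Finset.range (m + 3),
      if 0 < c x ∧ totalLead (m + 1) c x = 0 then x else 0 := by
    rw [labelMaj, Finset.sum_filter]
    refine Finset.sum_subset (fun x hx => ?_) (fun x hx hx' => ?_)
    · rw [Finset.mem_Icc] at hx
      exact Finset.mem_range.2 (by omega)
    · rw [Finset.mem_range] at hx
      rw [Finset.mem_Icc] at hx'
      split_ifs <;> omega
  rw [h1, Finset.sum_range_succ, Finset.sum_range_succ, Finset.sum_range_succ]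
  congr 1
  · congr 1
    · congr 1
      · refine Finset.sum_congr rfl fun x hx => ?_
        have hxm : x < m := Finset.mem_range.1 hx
        have hch := hc.chain x (by omega)
        refine if_congr ?_ rfl rfl
        simp only [totalLead, lead, Nat.add_lt_add_right hxm 1, if_true]
        clear hc hf h1 hx
        rcases x with - | x
        · simp [h0]
        · simp only [add_tsub_cancel_right, Nat.add_assoc, Nat.reduceAdd,
            show x + 1 < m + 1 by omega, show x < m + 1 by omega] at *
          grind (splits := 30)
      · refine if_congr ?_ rfl rfl
        simp only [totalLead, lead]
        clear hc h1
        rcases m with - | m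
        · simp [h0]
        · simp [Nat.add_assoc] at *
          grind (splits := 30)
    · refine if_congr ?_ rfl rfl
      simp only [totalLead, lead]
      clear hc h1
      simp [Nat.add_assoc]
      grind (splits := 30)
  · refine if_congr ?_ rfl rfl
    simp only [totalLead, lead]
    clear hc h1
    simp [Nat.add_assoc]
    grind (splits := 30)

/-- The admissible functions obtained from a chain count on the labels at most `m + 1`, whose
value `a` at `m` satisfies `R a`, by setting the values at `m + 1` and `m + 2` to `p` and `r`. -/
def IsForked (m p r : ℕ) (R : ℕ → Prop) (c : ℕ → ℕ) : Prop :=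
  IsAdmissible (m + 1) c ∧ c (m + 1) = p ∧ c (m + 2) = r ∧ R (c m)

theorem HasGF.fork {v p r k : ℕ} {R : ℕ → Prop} {s : ℚ[X]}
    (hg : HasGF (EndsWith (m + 1) v R) (chainMaj (m + 1)) s)
    (hR : ∀ a, R a → (a = v + 1 ∨ v = a + 1 ∨ (a = 0 ∧ v = 0) ∨ (v = 2 ∧ (a = 0 ∨ a = 2))) ∧
      (a = 2 → (v = 2 ↔ p = 1 ∧ r = 1)) ∧
      ((p = 0 ∧ r = 0 ∧ a ≤ 1) ∨ (p = 1 ∧ r = 1 ∧ (a = 0 ∨ a = 2)) ∨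
        ((p = r + 1 ∨ r = p + 1) ∧ (a = p + r + 1 ∨ a + 1 = p + r))) ∧
      ((v < a ∨ (a = 2 ∧ v = 2)) ↔ (a = p + r + 1 ∨ (a = 2 ∧ p = 1 ∧ r = 1))) ∧
      k = (if 0 < p ∧ a + 2 = 2 * p then m + 1 else 0) +
        (if 0 < r ∧ a + 2 = 2 * r then m + 2 else 0)) :
    HasGF (IsForked m p r R) (labelMaj (m + 1)) (X ^ k * s) := by
  have hu (c : ℕ → ℕ) (a b x : ℕ) (hx : x ≤ m) :
      Function.update (Function.update c (m + 1) a) (m + 2) b x = c x := by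
    rw [Function.update_of_ne (by omega), Function.update_of_ne (by omega)]
  have hs (c : ℕ → ℕ) (a b : ℕ) :
      Function.update (Function.update c (m + 1) a) (m + 2) b (m + 1) = a := by
    rw [Function.update_of_ne (by omega), Function.update_self]
  have hi (c : ℕ → ℕ) (a b a' b' : ℕ) : Function.update (Function.update (Function.update
      (Function.update c (m + 1) a) (m + 2) b) (m + 1) a') (m + 2) b' =
      Function.update (Function.update c (m + 1) a') (m + 2) b' := by
    rw [Function.update_comm (by omega : m + 2 ≠ m + 1), Function.update_idem, Function.update_idem]
  refine hg.map (fun d => Function.update (Function.update d (m + 1) p) (m + 2) r)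
    (fun c => Function.update (Function.update c (m + 1) v) (m + 2) 0) k ?_ ?_ ?_ ?_ ?_
  · rintro d ⟨h1, h2, h3⟩
    obtain ⟨-, hR2, hR3, -⟩ := hR _ h3
    obtain ⟨h4, h5, h6⟩ := isChainCount_succ_iff.1 h1
    refine ⟨isAdmissible_succ_iff.2 ⟨?_, ?_, ?_⟩, hs _ _ _, Function.update_self .., ?_⟩
    · rw [trim, hi, Function.update_comm (by omega : m + 1 ≠ m + 2), ← h1.support (m + 2) (by omega),
        Function.update_eq_self, h1.support (m + 2) (by omega)]
      exact h4
    · rw [hs, Function.update_self, hu _ _ _ m le_rfl, hu _ _ _ (m - 1) (m.sub_le 1)]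
      exact fun h7 h8 => (hR2 h7).1 (h2 ▸ h6 h7 h8)
    · rw [hs, Function.update_self, hu _ _ _ m le_rfl]
      exact hR3
    · rwa [hu _ _ _ m le_rfl]
  · rintro c ⟨h1, h2, h3, h4⟩
    obtain ⟨hR1, hR2, -⟩ := hR _ h4
    obtain ⟨h5, h6, -⟩ := isAdmissible_succ_iff.1 h1
    refine ⟨isChainCount_succ_iff.2 ⟨?_, ?_, ?_⟩, hs _ _ _, ?_⟩
    · rwa [Function.update_comm (by omega : m + 2 ≠ m + 1), Function.update_idem]
    · rw [hs, hu _ _ _ m le_rfl]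
      exact hR1
    · rw [hs, hu _ _ _ m le_rfl, hu _ _ _ (m - 1) (m.sub_le 1), ← h2, ← h3] at *
      exact fun h7 h8 => (hR2 h7).2 (h6 h7 h8)
    · rwa [add_tsub_cancel_right, hu _ _ _ m le_rfl]
  · rintro d ⟨h1, h2, h3⟩
    rw [hi, ← h2, Function.update_eq_self, ← h1.support (m + 2) (by omega),
      Function.update_eq_self]
  · rintro c ⟨h1, h2, h3, h4⟩
    rw [hi, ← h2, Function.update_eq_self, ← h3, Function.update_eq_self]
  · rintro c ⟨h1, h2, h3, h4⟩
    obtain ⟨-, -, -, hR4, rfl⟩ := hR _ h4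
    rw [labelMaj_succ h1, chainMaj, chainMaj, Finset.sum_range_succ, ← chainMaj, ← chainMaj, hs,
      hu _ _ _ m le_rfl, hu _ _ _ (m - 1) (m.sub_le 1), chainMaj_congr (hu c v 0), h2, h3,
      ← add_assoc]
    simp only [hR4]

theorem IsAdmissible.le_succ (hc : IsAdmissible (m + 1) c) {x : ℕ} (hx : x ≤ m) :
    c x ≤ x + 1 := by
  induction x with
  | zero => simp [hc.zero]
  | succ x ih =>
    have h1 := ih (by omega)
    have h2 := hc.chain x (by omega)
    omega

theorem hasGF_isAdmissible (m : ℕ) :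
    HasGF (IsAdmissible (m + 1)) (labelMaj (m + 1))
      (pathGF (m + 1) 0 + X ^ (2 * m + 3) * pathGF m 0 + plateauGF (m + 1) +
        ∑ k ∈ Finset.range (m + 1), (2 * (pathGF (m + 1) (2 * k + 1) - pathGF m (2 * k)) +
          (X ^ (m + 1) + X ^ (m + 2)) * pathGF m (2 * k))) := by
  have hU (k : ℕ) := (hasGF_endsWith (m + 1) k).1
  have hN (k : ℕ) := (hasGF_endsWith (m + 1) k).2
  have hA := (hN 0).fork (p := 0) (r := 0) (k := 0) (by intro a ha; grind)
  have hB := (hU 1).fork (p := 1) (r := 1) (k := 2 * m + 3) (by intro a ha; grind)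
  have hC := (hasGF_plateau (m + 1)).2.fork (p := 1) (r := 1) (k := 0) (by intro a ha; grind)
  have hD (k : ℕ) := (hN (2 * k + 1)).fork (p := k + 1) (r := k) (k := 0) (by intro a ha; grind)
  have hE (k : ℕ) := (hN (2 * k + 1)).fork (p := k) (r := k + 1) (k := 0) (by intro a ha; grind)
  have hF (k : ℕ) := (hU (2 * k + 1)).fork (p := k + 1) (r := k) (k := m + 1)
    (by intro a ha; grind)
  have hG (k : ℕ) := (hU (2 * k + 1)).fork (p := k) (r := k + 1) (k := m + 2)
    (by intro a ha; grind)
  have hDE (k : ℕ) := (((hD k).or (hE k) (by unfold IsForked; grind)).or (hF k)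
    (by unfold IsForked; grind)).or (hG k) (by unfold IsForked; grind)
  have hall := ((hA.or hB (by unfold IsForked; grind)).or hC (by unfold IsForked; grind)).or
    (.exists_lt hDE (by unfold IsForked; grind) (m + 1)) (by unfold IsForked; grind)
  refine hall.congr (fun c => ?_) (fun _ _ => rfl) ?_
  · constructor
    · intro hc
      obtain ⟨h1, h2, h3⟩ := isAdmissible_succ_iff.1 hc
      have hle := hc.le_succ (x := m) (by omega)
      simp only [IsForked, hc, true_and]
      by_cases h : c (m + 1) ≤ 1 ∧ c (m + 2) = c (m + 1)
      · refine .inl ?_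
        clear hU hN hA hB hC hD hE hF hG hDE hall
        grind
      · clear hU hN hA hB hC hD hE hF hG hDE hall
        obtain h4 | h4 : c (m + 1) = c (m + 2) + 1 ∨ c (m + 2) = c (m + 1) + 1 := by omega
        · exact .inr ⟨c (m + 2), by omega, by clear hc h1 h2 hle; omega⟩
        · exact .inr ⟨c (m + 1), by omega, by clear hc h1 h2 hle; omega⟩
    · rintro (((h | h) | h) | ⟨k, -, ((h | h) | h) | h⟩) <;> exact h.1
  · simp only [upGF_zero, show ∀ k, upGF (m + 1) (k + 1) = pathGF m k from fun _ => rfl, pow_zero,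
      one_mul, sub_zero]
    congr 1
    exact Finset.sum_congr rfl fun k _ => by ring

end Fork

section GaloisNumbers

open Polynomial

/-- The Galois number `∑ᵢ [n choose i]_q`. -/
noncomputable def galoisQ (n : ℕ) : ℚ[X] := ∑ i ∈ Finset.range (n + 1), qbinomQ n i

theorem galoisQ_add_two (n : ℕ) :
    galoisQ (n + 2) = 2 * galoisQ (n + 1) - (1 - X ^ (n + 1)) * galoisQ n := by
  have h1 : galoisQ (n + 1) = ∑ k ∈ Finset.range (n + 2), qbinomQ (n + 1) (k + 1) + 1 := by
    rw [← qbinomQ_zero_right (n + 1), ← Finset.sum_range_succ', Finset.sum_range_succ,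
      qbinomQ_eq_zero (by omega), add_zero, galoisQ]
  have h2 : galoisQ n = ∑ k ∈ Finset.range (n + 2), qbinomQ n k := by
    rw [Finset.sum_range_succ, qbinomQ_eq_zero (by omega), add_zero, galoisQ]
  rw [galoisQ, Finset.sum_range_succ', qbinomQ_zero_right]
  simp only [qbinomQ_add_two_succ, Finset.sum_sub_distrib, Finset.sum_add_distrib,
    ← Finset.mul_sum, ← h2]
  rw [show ∑ k ∈ Finset.range (n + 2), qbinomQ (n + 1) k = galoisQ (n + 1) from rfl]
  linear_combination -h1

theorem galoisQ_succ_sub (m : ℕ) :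
    galoisQ (m + 1) - galoisQ m = 1 + ∑ h ∈ Finset.Icc 1 m, X ^ h * galoisQ (h - 1) := by
  induction m with
  | zero => simp [galoisQ, Finset.sum_range_succ, qbinomQ]
  | succ m ih =>
    rw [Finset.sum_Icc_succ_top (by omega), ← add_assoc, ← ih, galoisQ_add_two,
      add_tsub_cancel_right]
    ring

theorem galoisQ_two_mul_add_one (t : ℕ) :
    galoisQ (2 * t + 1) = 2 * ∑ i ∈ Finset.range (t + 1), qbinomQ (2 * t + 1) i := by
  have h : ∑ i ∈ Finset.range (t + 1), qbinomQ (2 * t + 1) (t + 1 + i) =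
      ∑ i ∈ Finset.range (t + 1), qbinomQ (2 * t + 1) i := by
    rw [← Finset.sum_range_reflect]
    refine Finset.sum_congr rfl fun i hi => qbinomQ_symm ?_
    rw [Finset.mem_range] at hi
    omega
  rw [galoisQ, show 2 * t + 1 + 1 = (t + 1) + (t + 1) by ring, Finset.sum_range_add, h]
  ring

theorem galoisQ_two_mul (t : ℕ) :
    galoisQ (2 * t) = 2 * ∑ i ∈ Finset.range t, qbinomQ (2 * t) i + qbinomQ (2 * t) t := by
  have h : ∑ i ∈ Finset.range t, qbinomQ (2 * t) (t + 1 + i) =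
      ∑ i ∈ Finset.range t, qbinomQ (2 * t) i := by
    rw [← Finset.sum_range_reflect]
    refine Finset.sum_congr rfl fun i hi => qbinomQ_symm ?_
    rw [Finset.mem_range] at hi
    omega
  rw [galoisQ, show 2 * t + 1 = (t + 1) + t by ring, Finset.sum_range_add, Finset.sum_range_succ, h]
  ring

theorem sum_range_ite_two_mul_le (m : ℕ) (f : ℕ → ℚ[X]) :
    ∑ k ∈ Finset.range (m + 1), (if 2 * k ≤ m then f ((m - 2 * k) / 2) else 0) =
      ∑ i ∈ Finset.range (m / 2 + 1), f i := by
  rw [← Finset.sum_range_reflect f, ← Finset.sum_subset (s₁ := Finset.range (m / 2 + 1))]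
  · refine Finset.sum_congr rfl fun k hk => ?_
    rw [Finset.mem_range] at hk
    rw [if_pos (by omega)]
    congr 1
    omega
  · exact Finset.range_mono (by omega)
  · intro k _ hk
    rw [Finset.mem_range] at hk
    exact if_neg (by omega)

theorem sum_pathGF_two_mul (m : ℕ) :
    ∑ k ∈ Finset.range (m + 1), pathGF m (2 * k) =
      ∑ i ∈ Finset.range (m / 2 + 1), qbinomQ m i :=
  sum_range_ite_two_mul_le m (qbinomQ m)

theorem sum_pathGF_two_mul_add_one (m : ℕ) :
    ∑ k ∈ Finset.range (m + 1), pathGF (m + 1) (2 * k + 1) =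
      ∑ i ∈ Finset.range (m / 2 + 1), qbinomQ (m + 1) i := by
  rw [← sum_range_ite_two_mul_le]
  simp only [pathGF, add_le_add_iff_right, Nat.add_sub_add_right]

theorem plateauGF_succ (m : ℕ) :
    plateauGF (m + 1) = pathGF (m + 1) 1 + pathGF (m + 1) 0 - pathGF m 0 - 1 := by
  induction m with
  | zero => simp [plateauGF, pathGF, upGF, qbinomQ_zero_right]
  | succ m ih =>
    have h0 := pathGF_succ (m + 1) 0
    have h1 := pathGF_succ (m + 1) 1
    simp only [upGF, if_pos, one_ne_zero, if_false] at h0 h1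
    rw [plateauGF, Finset.sum_range_succ, ← plateauGF, ih]
    simp only [upGF]
    linear_combination -h0 - h1

theorem sum_Icc_pow_mul_qbinomQ (t : ℕ) :
    ∑ h ∈ Finset.Icc 1 t, X ^ (2 * t + 1 - h) * qbinomQ (2 * t - h) t =
      qbinomQ (2 * t + 1) t - qbinomQ (2 * t) t := by
  have h (N : ℕ) : ∑ i ∈ Finset.range N, X ^ i * qbinomQ (t + i) t = qbinomQ (t + N) (t + 1) := by
    induction N with
    | zero => rw [add_zero, qbinomQ_eq_zero (by omega), Finset.sum_range_zero]
    | succ N ih =>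
      rw [Finset.sum_range_succ, ih, ← add_assoc, qbinomQ_succ_succ_of_add (j := N) rfl]
  rw [qbinomQ_symm (show t + (t + 1) = 2 * t + 1 by omega), qbinomQ, add_sub_cancel_left,
    two_mul, ← h, Finset.mul_sum]
  refine Finset.sum_nbij' (t - ·) (t - ·) ?_ ?_ ?_ ?_ ?_ <;> intro i hi <;>
    simp only [Finset.mem_Icc, Finset.mem_range] at hi ⊢
  any_goals omega
  rw [← mul_assoc, ← pow_add]
  congr 2 <;> omega

theorem pathGF_sum_eq (m : ℕ) :
    pathGF (m + 1) 0 + X ^ (2 * m + 3) * pathGF m 0 + plateauGF (m + 1) +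
      ∑ k ∈ Finset.range (m + 1), (2 * (pathGF (m + 1) (2 * k + 1) - pathGF m (2 * k)) +
        (X ^ (m + 1) + X ^ (m + 2)) * pathGF m (2 * k)) =
    Pn (m + 1) + (X ^ (2 * (m + 1) + 1) - X ^ (m + 1)) * qbinomQ m (m / 2) +
      qbinomQ (m + 2) ((m + 2) / 2) := by
  have hG := galoisQ_succ_sub m
  have h0 := pathGF_succ (m + 1) 0
  simp only [upGF, if_pos] at h0
  have hC2 : (C (1 / 2 : ℚ) : ℚ[X]) * 2 = 1 := by
    rw [← C_ofNat, ← C_mul]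
    norm_num
  have e1 : qbinomQ m (m / 2) = pathGF m 0 := by simp [pathGF]
  have e2 : qbinomQ (m + 2) ((m + 2) / 2) = pathGF (m + 2) 0 := by simp [pathGF]
  have hg : ∑ h ∈ Finset.Icc 1 m, (X : ℚ[X]) ^ h * ∑ i ∈ Finset.range h, qbinomQ (h - 1) i =
      ∑ h ∈ Finset.Icc 1 m, X ^ h * galoisQ (h - 1) := by
    refine Finset.sum_congr rfl fun h hh => ?_
    rw [galoisQ, Nat.sub_add_cancel (Finset.mem_Icc.1 hh).1]
  rw [e1, e2, plateauGF_succ, Finset.sum_add_distrib, ← Finset.mul_sum, ← Finset.mul_sum,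
    Finset.sum_sub_distrib, sum_pathGF_two_mul, sum_pathGF_two_mul_add_one, Pn]
  simp only [add_tsub_cancel_right, hg, e1]
  rw [← galoisQ]
  rcases Nat.even_or_odd' m with ⟨t, rfl | rfl⟩
  · have hP := sum_Icc_pow_mul_qbinomQ t
    have hB := galoisQ_two_mul_add_one t
    have hC := galoisQ_two_mul t
    have h1 : pathGF (2 * t + 1) 0 = qbinomQ (2 * t + 1) t := by
      rw [pathGF, if_pos (by omega)]; congr 1; omega
    have h2 : pathGF (2 * t) 0 = qbinomQ (2 * t) t := by
      rw [pathGF, if_pos (by omega)]; congr 1; omega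
    have h3 : ∑ h ∈ Finset.Icc 1 t, X ^ (2 * t + 1 - h) * qbinomQ (2 * t + 1 - h - 1) t =
        pathGF (2 * t + 1) 0 - pathGF (2 * t) 0 := by
      rw [h1, h2, ← sum_Icc_pow_mul_qbinomQ]
      exact Finset.sum_congr rfl fun h _ => by rw [Nat.sub_right_comm, add_tsub_cancel_right]
    rw [if_neg (by simp), Nat.mul_div_cancel_left _ Nat.two_pos, h3]
    have hC' : 2 * ∑ i ∈ Finset.range (t + 1), qbinomQ (2 * t) i =
        galoisQ (2 * t) + pathGF (2 * t) 0 := by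
      rw [hC, h2, Finset.sum_range_succ]
      ring
    linear_combination -h0 - hB + hG - hC' + (X ^ (2 * t + 1) + X ^ (2 * t + 2)) *
      (C (1 / 2) * hC' - (∑ i ∈ Finset.range (t + 1), qbinomQ (2 * t) i) * hC2)
  · have hB := galoisQ_two_mul (t + 1)
    have hC := galoisQ_two_mul_add_one t
    have h1 : pathGF (2 * t + 2) 0 = qbinomQ (2 * t + 2) (t + 1) := by
      rw [pathGF, if_pos (by omega)]; congr 1; omega
    rw [if_pos (by simp [Nat.even_add_one]), show (2 * t + 1) / 2 = t by omega]
    linear_combination -h0 - hB + hG + hC + h1 + (X ^ (2 * t + 2) + X ^ (2 * t + 3)) *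
      (-C (1 / 2) * hC - (∑ i ∈ Finset.range (t + 1), qbinomQ (2 * t + 1) i) * hC2)

end GaloisNumbers
/-- The sum of `q^{maj(w)}` over all fully commutative involutions `w` of the Coxeter
group of type `D_{n+1}` equals
`P_n(q) + (q^{2n+1} - q^n)·[n-1 choose ⌊(n-1)/2⌋]_q + [n+1 choose ⌊(n+1)/2⌋]_q`
in `ℚ[q]`. -/
theorem majorIndex_gf_fcInvolutions_typeD (n : ℕ) (hn : 1 ≤ n) :
    ∃ S : Finset (typeD n).Group,
      (∀ w, w ∈ S ↔ IsFCInvolution (typeD n).toCoxeterSystem w) ∧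
      ∑ w ∈ S, (Polynomial.X : Polynomial ℚ) ^ majorIndex (typeD n).toCoxeterSystem w =
        Pn n +
          (Polynomial.X ^ (2 * n + 1) - Polynomial.X ^ n) * qbinomQ (n - 1) ((n - 1) / 2) +
          qbinomQ (n + 1) ((n + 1) / 2) := by
  obtain ⟨m, rfl⟩ := Nat.exists_eq_add_of_le' hn
  obtain ⟨F, hF, hsum⟩ := hasGF_isAdmissible m
  obtain ⟨S, hS, hS'⟩ := exists_finset_isFCInvolution hn hF
  exact ⟨S, hS, by rw [hS', hsum, pathGF_sum_eq, add_tsub_cancel_right]⟩
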